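/- Let K be a Grothendieck abelian category and C a deconstructible class of objects. Then for any small category I (in particular for the category indexing chain complexes), the class of functors/diagrams X: I → K with all values X(i) obtained so that pointwise C-monomorphisms cofibrantly generate—specifically, the class C(C) of chain complexes over K all of whose components lie in C—is deconstructible in the category of complexes C(K). -/

import Mathlib

open CategoryTheory Category Limits Opposite

universe w v u u' u''

namespace CellularPaper

variable {K : Type u} [Category.{v} K]

/-- The restriction of a chain `F : J ⥤ K` to the elements below `j`. -/
def restrictionLT {J : Type w} [Preorder J] (F : J ⥤ K) (j : J) :
    {i : J // i < j} ⥤ K :=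
  (Monotone.functor (f := fun i : {i : J // i < j} => (i : J)) fun _ _ h => h) ⋙ F

/-- The cocone on the restriction of `F` below `j` with apex `F.obj j`. -/
@[simps]
def coconeLT {J : Type w} [Preorder J] (F : J ⥤ K) (j : J) :
    Cocone (restrictionLT F j) where
  pt := F.obj j
  ι :=
    { app := fun i => F.map (homOfLE i.2.le)
      naturality := fun i i' h => by
        dsimp [restrictionLT, Monotone.functor]
        rw [← F.map_comp]
        simp }

/-- `f` is a transfinite composite of a smooth chain with links in `C`. -/
def IsTransfiniteCompositionOf (C : MorphismProperty K) : MorphismProperty K :=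
  fun A B f =>
    ∃ (J : Type w) (_ : LinearOrder J) (_ : SuccOrder J) (_ : OrderBot J)
      (_ : WellFoundedLT J) (F : J ⥤ K) (c : Cocone F) (_ : IsColimit c)
      (eA : A ≅ F.obj ⊥) (eB : c.pt ≅ B),
      (∀ j : J, ¬IsMax j → C (F.map (homOfLE (Order.le_succ j)))) ∧
      (∀ j : J, Order.IsSuccLimit j → Nonempty (IsColimit (coconeLT F j))) ∧
      eA.hom ≫ c.ι.app ⊥ ≫ eB.hom = f

/-- A cellular structure: a class of morphisms containing all isomorphisms and closed
under pushout and transfinite composition. -/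
structure IsCellular (C : MorphismProperty K) : Prop where
  isos : ∀ {A B : K} (f : A ⟶ B), IsIso f → C f
  pushout : ∀ {A B A' B' : K} {f : A ⟶ B} {u : A ⟶ A'} {v : B ⟶ B'} {g : A' ⟶ B'},
    IsPushout f u v g → C f → C g
  transfinite : ∀ {A B : K} (f : A ⟶ B), IsTransfiniteCompositionOf.{v} C f → C f

/-- `f` is a retract of `g` in the arrow category. -/
def IsRetractOf {A B X Y : K} (f : A ⟶ B) (g : X ⟶ Y) : Prop :=
  ∃ (u : A ⟶ X) (v : B ⟶ Y) (r : X ⟶ A) (s : Y ⟶ B),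
    u ≫ g = f ≫ v ∧ r ≫ f = g ≫ s ∧ u ≫ r = 𝟙 A ∧ v ≫ s = 𝟙 B

/-- The class of retracts of morphisms in `C`. -/
def retracts (C : MorphismProperty K) : MorphismProperty K :=
  fun _ _ f => ∃ (X Y : K) (g : X ⟶ Y), C g ∧ IsRetractOf f g

/-- The class of pushouts of morphisms in `C`. -/
def Po (C : MorphismProperty K) : MorphismProperty K :=
  fun A' B' g => ∃ (A B : K) (f : A ⟶ B) (u : A ⟶ A') (v : B ⟶ B'),
    C f ∧ IsPushout f u v g

/-- A κ-directed preorder. -/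
def IsCardinalDirected (P : Type v) [Preorder P] (κ : Cardinal.{v}) : Prop :=
  ∀ S : Set P, Cardinal.mk S < κ → ∃ p : P, ∀ s ∈ S, s ≤ p

/-- A κ-presentable object: its hom-functor preserves κ-directed colimits. -/
def IsCardinalPresentable (κ : Cardinal.{v}) (A : K) : Prop :=
  ∀ (P : Type v) (_ : Preorder P), IsCardinalDirected P κ →
    Nonempty (PreservesColimitsOfShape P (coyoneda.obj (op A)))

/-- A locally κ-presentable category. -/
structure IsLocallyPresentable (κ : Cardinal.{v}) (K : Type u) [Category.{v} K] : Prop where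
  regular : κ.IsRegular
  hasColimits : HasColimits K
  generators : ∃ (ι : Type v) (G : ι → K), (∀ i, IsCardinalPresentable κ (G i)) ∧
    ∀ X : K, ∃ (P : Type v) (_ : Preorder P) (F : P ⥤ K) (c : Cocone F) (_ : IsColimit c),
      IsCardinalDirected P κ ∧ Nonempty (c.pt ≅ X) ∧ ∀ p : P, ∃ i, Nonempty (F.obj p ≅ G i)

/-- A locally presentable category. -/
def LocallyPresentable (K : Type u) [Category.{v} K] : Prop :=
  ∃ κ : Cardinal.{v}, IsLocallyPresentable κ K

/-- The smallest cellular class containing `X`. -/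
def cellClosure (X : MorphismProperty K) : MorphismProperty K :=
  fun _ _ f => ∀ C : MorphismProperty K, IsCellular C → X ≤ C → C f

/-- `cof(X)`: retracts of transfinite composites of pushouts of `X`. -/
def cofClosure (X : MorphismProperty K) : MorphismProperty K :=
  retracts (IsTransfiniteCompositionOf.{v} (Po X))

/-- The morphism property generated by a family of morphisms. -/
def ofFamily {ι : Type*} {a b : ι → K} (s : ∀ i, a i ⟶ b i) : MorphismProperty K :=
  fun _ _ f => ∃ i, Nonempty (Arrow.mk f ≅ Arrow.mk (s i))

/-- `C` is cofibrantly generated by a set of morphisms. -/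
def IsCofibrantlyGenerated (C : MorphismProperty K) : Prop :=
  ∃ (ι : Type v) (a b : ι → K) (s : ∀ i, a i ⟶ b i),
    C = cofClosure (ofFamily s)

/-- A combinatorial structure on a locally presentable category. -/
structure IsCombinatorial (K : Type u) [Category.{v} K] (C : MorphismProperty K) : Prop where
  locallyPresentable : LocallyPresentable K
  cellular : IsCellular C
  retractClosed : retracts C ≤ C
  cofibrantlyGenerated : IsCofibrantlyGenerated C

/-- `f` is a transfinite composite of length `< κ` of morphisms in `C`. -/
def IsBoundedTransfiniteCompositionOf (κ : Cardinal.{v}) (C : MorphismProperty K) :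
    MorphismProperty K :=
  fun A B f =>
    ∃ (J : Type v) (_ : LinearOrder J) (_ : SuccOrder J) (_ : OrderBot J)
      (_ : WellFoundedLT J), Cardinal.mk J < κ ∧
      ∃ (F : J ⥤ K) (c : Cocone F) (_ : IsColimit c)
        (eA : A ≅ F.obj ⊥) (eB : c.pt ≅ B),
        (∀ j : J, ¬IsMax j → C (F.map (homOfLE (Order.le_succ j)))) ∧
        (∀ j : J, Order.IsSuccLimit j → Nonempty (IsColimit (coconeLT F j))) ∧
        eA.hom ≫ c.ι.app ⊥ ≫ eB.hom = f

/-- The morphisms of `C` with κ-presentable domain and codomain. -/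
def betweenPresentable (κ : Cardinal.{v}) (C : MorphismProperty K) : MorphismProperty K :=
  fun A B f => C f ∧ IsCardinalPresentable κ A ∧ IsCardinalPresentable κ B

/-- `Po_κ(X)`: pushouts of morphisms of `X` between κ-presentable objects. -/
def PoCard (κ : Cardinal.{v}) (X : MorphismProperty K) : MorphismProperty K :=
  betweenPresentable κ (Po X)

/-- The category `psh(K²)`: objects are morphisms of `K`, morphisms are pushout squares. -/
structure PshArrow (K : Type u) [Category.{v} K] : Type max u v where
  arr : Arrow K

instance : Category.{v} (PshArrow K) where
  Hom g f := {φ : g.arr ⟶ f.arr // IsPushout g.arr.hom φ.left φ.right f.arr.hom}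
  id g := ⟨𝟙 _, IsPushout.of_vert_isIso ⟨by simp⟩⟩
  comp φ ψ := ⟨φ.1 ≫ ψ.1, φ.2.paste_vert ψ.2⟩
  id_comp φ := Subtype.ext (Category.id_comp _)
  comp_id φ := Subtype.ext (Category.comp_id _)
  assoc _ _ _ := Subtype.ext (Category.assoc _ _ _)


section PsPull

variable {K : Type u} {L : Type u'} {M : Type u''}
variable [Category.{v} K] [Category.{v} L] [Category.{v} M]

/-- The pseudopullback of `F : K ⥤ M` and `G : L ⥤ M`. -/
structure PsPull (F : K ⥤ M) (G : L ⥤ M) : Type max u u' v where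
  k : K
  l : L
  t : F.obj k ≅ G.obj l

variable {F : K ⥤ M} {G : L ⥤ M}

/-- Morphisms in the pseudopullback. -/
@[ext]
structure PsHom (a b : PsPull F G) : Type v where
  hk : a.k ⟶ b.k
  hl : a.l ⟶ b.l
  w : F.map hk ≫ b.t.hom = a.t.hom ≫ G.map hl

instance : Category.{v} (PsPull F G) where
  Hom := PsHom
  id a := ⟨𝟙 _, 𝟙 _, by simp⟩
  comp f g := ⟨f.hk ≫ g.hk, f.hl ≫ g.hl, by
    rw [F.map_comp, G.map_comp, Category.assoc, g.w, ← Category.assoc, f.w,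
      Category.assoc]⟩

/-- The first projection of the pseudopullback. -/
def projK (F : K ⥤ M) (G : L ⥤ M) : PsPull F G ⥤ K where
  obj a := a.k
  map f := f.hk

/-- The second projection of the pseudopullback. -/
def projL (F : K ⥤ M) (G : L ⥤ M) : PsPull F G ⥤ L where
  obj a := a.l
  map f := f.hl

/-- `Ps(C, D)`: morphisms of the pseudopullback whose projections lie in `C` and `D`. -/
def PsClass (C : MorphismProperty K) (D : MorphismProperty L) :
    MorphismProperty (PsPull F G) :=
  fun _ _ f => C f.hk ∧ D f.hl

end PsPull


open ZeroObject in
/-- The class of `S`-filtered objects: `X` such that `0 ⟶ X` is a transfinite composite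
of monomorphisms with cokernels in `S`. -/
def filteredBy {K : Type u} [Category.{v} K] [Abelian K] (S : Set K) : Set K :=
  {X : K | IsTransfiniteCompositionOf.{v}
    (fun _ _ f => Mono f ∧ ∃ s ∈ S, Nonempty (cokernel f ≅ s))
    (0 : (0 : K) ⟶ X)}

/-- A class of objects is deconstructible if it is the class of `S`-filtered objects
for some set `S`. -/
def Deconstructible {K : Type u} [Category.{v} K] [Abelian K] (C : Set K) : Prop :=
  ∃ (ι : Type v) (s : ι → K), C = filteredBy (Set.range s)

section Lattice

variable {L : Type u} [CompleteLattice L]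

/-- The join of `a` with the members of the family `A` of index `< j`. -/
def stage {J : Type v} [LT J] (a : L) (A : J → L) (j : J) : L := a ⊔ ⨆ i, ⨆ (_ : i < j), A i

/-- `b` is obtained from `a` by a well-ordered sequence of joins whose nontrivial steps are
related by `R`. -/
def FilteredBetween (R : L → L → Prop) (a b : L) : Prop :=
  ∃ (J : Type v) (_ : LinearOrder J) (_ : WellFoundedLT J) (A : J → L),
    a ⊔ ⨆ j, A j = b ∧ ∀ j, A j ≤ stage a A j ∨ R (stage a A j) (stage a A j ⊔ A j)

section stage

variable {J : Type v} {a : L} {A : J → L}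

lemma le_stage [LT J] (j : J) : a ≤ stage a A j := le_sup_left

lemma apply_le_stage [LT J] {i j : J} (h : i < j) : A i ≤ stage a A j :=
  le_sup_of_le_right (le_iSup₂_of_le i h le_rfl)

lemma stage_le [LT J] {j : J} {b : L} (ha : a ≤ b) (h : ∀ i < j, A i ≤ b) : stage a A j ≤ b :=
  sup_le ha (iSup₂_le h)

lemma stage_mono [Preorder J] {i j : J} (h : i ≤ j) : stage a A i ≤ stage a A j :=
  stage_le (le_stage j) fun _ hk => apply_le_stage (hk.trans_le h)

end stage

lemma FilteredBetween.refl (R : L → L → Prop) (a : L) : FilteredBetween.{v} R a a :=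
  ⟨PEmpty, inferInstance, inferInstance, fun _ => ⊥, by simp, fun j => j.elim⟩

/-- Trivial steps can be removed from a filtration. -/
lemma FilteredBetween.exists_strict {R : L → L → Prop} {a b : L}
    (h : FilteredBetween.{v} R a b) :
    ∃ (J : Type v) (_ : LinearOrder J) (_ : WellFoundedLT J) (A : J → L),
      a ⊔ ⨆ j, A j = b ∧ ∀ j, R (stage a A j) (stage a A j ⊔ A j) := by
  obtain ⟨J, _, _, A, rfl, hA⟩ := h
  let B : {j // ¬ A j ≤ stage a A j} → L := fun j => A j
  have key : ∀ (c : L) (j : J), a ≤ c → (∀ k : {j // ¬ A j ≤ stage a A j}, k < j → B k ≤ c) →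
      stage a A j ≤ c := by
    intro c j
    induction j using WellFoundedLT.induction with
    | _ j ih =>
      intro hc h
      refine stage_le hc fun i hi => ?_
      by_cases hi' : A i ≤ stage a A i
      · exact hi'.trans (ih i hi hc fun k hk => h k (hk.trans hi))
      · exact h ⟨i, hi'⟩ hi
  have hst : ∀ j, stage a B j = stage a A j := fun j =>
    le_antisymm (stage_le (le_stage _) fun i hi => apply_le_stage (A := A) hi)
      (key _ _ (le_stage _) fun k hk => apply_le_stage (A := B) hk)
  refine ⟨_, inferInstance, inferInstance, B, le_antisymm ?_ ?_, fun j => ?_⟩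
  · exact sup_le le_sup_left (iSup_le fun j => le_sup_of_le_right (le_iSup A j.1))
  · refine sup_le le_sup_left (iSup_le fun j => ?_)
    by_cases hj : A j ≤ stage a A j
    · exact hj.trans (key _ _ le_sup_left fun k _ => le_sup_of_le_right (le_iSup B k))
    · exact le_sup_of_le_right (le_iSup B ⟨j, hj⟩)
  · rw [hst]
    exact (hA j).resolve_left j.2

lemma FilteredBetween.mono {R R' : L → L → Prop} (hR : ∀ x y, R x y → R' x y) {a b : L}
    (h : FilteredBetween.{v} R a b) : FilteredBetween.{v} R' a b := by
  obtain ⟨J, i₁, i₂, A, h, hA⟩ := h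
  exact ⟨J, i₁, i₂, A, h, fun j => (hA j).imp_right (hR _ _)⟩

/-- A filtration whose steps are filtered can be refined. -/
lemma FilteredBetween.refine {R : L → L → Prop} {a b : L}
    (h : FilteredBetween.{v} (FilteredBetween.{v} R) a b) : FilteredBetween.{v} R a b := by
  obtain ⟨J, _, _, A, rfl, hA⟩ := h
  have hA' : ∀ j, FilteredBetween.{v} R (stage a A j) (stage a A j ⊔ A j) := fun j =>
    (hA j).elim (fun h => by rw [sup_eq_left.2 h]; exact FilteredBetween.refl _ _) id
  choose I i₁ i₂ B hB hR using hA'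
  let C : (Σₗ j, I j) → L := fun p => B p.1 p.2
  have hBA : ∀ j k, B j k ≤ stage a A j ⊔ A j := fun j k =>
    (le_iSup (B j) k).trans (le_sup_right.trans (hB j).le)
  have key : ∀ (c : L) (j : J), a ≤ c → (∀ i < j, ∀ k, B i k ≤ c) → stage a A j ≤ c := by
    intro c j
    induction j using WellFoundedLT.induction with
    | _ j ih =>
      intro hc h
      refine stage_le hc fun i hi => ?_
      refine (le_sup_right.trans (hB i).ge).trans (sup_le (ih i hi hc fun l hl => ?_)
        (iSup_le (h i hi)))
      exact h l (hl.trans hi)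
  have hst : ∀ j k, stage a C (toLex ⟨j, k⟩) = stage (stage a A j) (B j) k := by
    intro j k
    refine le_antisymm (stage_le ((le_stage j).trans (le_stage k)) ?_) (stage_le ?_ ?_)
    · intro ⟨i, l⟩ hil
      obtain ⟨_, _, h⟩ | ⟨_, _, h⟩ := hil
      · exact (hBA i l).trans ((sup_le (stage_mono h.le) (apply_le_stage h)).trans (le_stage _))
      · exact apply_le_stage (A := B j) h
    · exact key _ _ (le_stage _) fun i hi l =>
        apply_le_stage (A := C) (i := toLex ⟨i, l⟩) (Sigma.Lex.left _ _ hi)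
    · exact fun l hl => apply_le_stage (A := C) (i := toLex ⟨j, l⟩) (Sigma.Lex.right _ _ hl)
  refine ⟨Σₗ j, I j, inferInstance, ?_, C, le_antisymm ?_ ?_, fun ⟨j, k⟩ => ?_⟩
  · refine ⟨⟨fun ⟨j, k⟩ => ?_⟩⟩
    induction j using WellFoundedLT.induction with
    | _ j ihj =>
      induction k using WellFoundedLT.induction with
      | _ k ihk =>
        refine Acc.intro _ ?_
        rintro ⟨i, l⟩ (⟨_, _, h⟩ | ⟨_, _, h⟩)
        · exact ihj i h l
        · exact ihk l h
  · refine sup_le le_sup_left (iSup_le fun p => (hBA p.1 p.2).trans (sup_le ?_ ?_))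
    · exact stage_le le_sup_left fun i _ => le_sup_of_le_right (le_iSup A i)
    · exact le_sup_of_le_right (le_iSup A p.1)
  · have hC : ∀ j k, B j k ≤ a ⊔ ⨆ p, C p := fun j k =>
      le_sup_of_le_right (le_iSup C (toLex ⟨j, k⟩))
    refine sup_le le_sup_left (iSup_le fun j => (le_sup_right.trans (hB j).ge).trans
      (sup_le (key _ _ le_sup_left fun i _ => hC i) (iSup_le (hC j))))
  · exact (hst j k).symm ▸ hR j k

section Transfer

variable {M : Type w} [CompleteLattice M] {φ : L → M} {R : L → L → Prop} {R' : M → M → Prop}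

lemma map_stage (hφ : ∀ s t, φ (s ⊔ t) = φ s ⊔ φ t)
    (hφ' : ∀ {ι : Type v} (f : ι → L), φ (⨆ i, f i) = ⨆ i, φ (f i))
    {J : Type v} [LT J] (a : L) (A : J → L) (j : J) :
    φ (stage a A j) = stage (φ a) (φ ∘ A) j := by
  simp only [stage, hφ, iSup_subtype', hφ', Function.comp]

lemma FilteredBetween.map (hφ : ∀ s t, φ (s ⊔ t) = φ s ⊔ φ t)
    (hφ' : ∀ {ι : Type v} (f : ι → L), φ (⨆ i, f i) = ⨆ i, φ (f i)) {a b : L}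
    (hR : ∀ s t, a ≤ s → R s t → R' (φ s) (φ t)) (h : FilteredBetween.{v} R a b) :
    FilteredBetween.{v} R' (φ a) (φ b) := by
  obtain ⟨J, i₁, i₂, A, rfl, hA⟩ := h
  refine ⟨J, i₁, i₂, φ ∘ A, by simp [hφ, hφ', Function.comp], fun j => ?_⟩
  rw [← map_stage hφ hφ', Function.comp, ← hφ]
  refine (hA j).imp (fun h => ?_) (hR _ _ (le_stage j))
  rw [← sup_eq_left, ← hφ, sup_eq_left.2 h]

lemma FilteredBetween.comap (hφ : ∀ s t, φ (s ⊔ t) = φ s ⊔ φ t)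
    (hφ' : ∀ {ι : Type v} (f : ι → L), φ (⨆ i, f i) = ⨆ i, φ (f i)) {a b : L}
    (hle : ∀ s t, a ≤ s → φ t ≤ φ s → t ≤ s)
    (hR : ∀ s t, a ≤ s → s ≤ t → R' (φ s) (φ t) → R s t) (hab : a ≤ b)
    (hsurj : ∀ s, s ≤ φ b → ∃ t, φ t = s)
    (h : FilteredBetween.{v} R' (φ a) (φ b)) : FilteredBetween.{v} R a b := by
  obtain ⟨J, i₁, i₂, A, hb, hA⟩ := h
  have hAb : ∀ j, A j ≤ φ b := fun j => (le_iSup A j).trans (le_sup_right.trans hb.le)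
  choose B hB using fun j => hsurj (A j) (hAb j)
  obtain rfl : A = φ ∘ B := funext fun j => (hB j).symm
  have hb' : φ (a ⊔ ⨆ j, B j) = φ b := by rw [hφ, hφ']; exact hb
  refine ⟨J, i₁, i₂, B, le_antisymm (hle _ _ hab hb'.le) (hle _ _ le_sup_left hb'.ge),
    fun j => ?_⟩
  have := hA j
  rw [← map_stage hφ hφ', Function.comp, ← hφ] at this
  exact this.imp (hle _ _ (le_stage j)) (hR _ _ (le_stage j) le_sup_left)

end Transfer

section Hill

/-- Binary meets distribute over directed joins indexed by types in `Type v`. -/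
def IsUpperContinuous (L : Type u) [CompleteLattice L] : Prop :=
  ∀ (ι : Type v) [Nonempty ι] (f : ι → L) (y : L), Directed (· ≤ ·) f →
    (⨆ i, f i) ⊓ y ≤ ⨆ i, f i ⊓ y

variable {J : Type v}

/-- The join of the members of the family `A` with index in `S`. -/
def joinOver (A : J → L) (S : Set J) : L := ⨆ i ∈ S, A i

lemma le_joinOver {A : J → L} {S : Set J} {i : J} (h : i ∈ S) : A i ≤ joinOver A S :=
  le_iSup₂_of_le i h le_rfl

lemma joinOver_le {A : J → L} {S : Set J} {b : L} (h : ∀ i ∈ S, A i ≤ b) : joinOver A S ≤ b :=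
  iSup₂_le h

lemma joinOver_mono (A : J → L) {S T : Set J} (h : S ⊆ T) : joinOver A S ≤ joinOver A T :=
  joinOver_le fun _ hi => le_joinOver (h hi)

lemma joinOver_union (A : J → L) (S T : Set J) :
    joinOver A (S ∪ T) = joinOver A S ⊔ joinOver A T :=
  le_antisymm (joinOver_le fun _ hi => hi.elim (fun h => le_sup_of_le_left (le_joinOver h))
      fun h => le_sup_of_le_right (le_joinOver h))
    (sup_le (joinOver_mono A Set.subset_union_left) (joinOver_mono A Set.subset_union_right))

/-- A small element below a join lies below a small subjoin. -/
lemma exists_small_joinOver_le (hL : IsUpperContinuous.{v} L) {κ : Type v} [Infinite κ]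
    (A : J → L) {y : L} (hy : ∃ f : Set.Iic y → κ, Function.Injective f) {S : Set J}
    (h : y ≤ joinOver A S) :
    ∃ S' ⊆ S, Cardinal.mk S' ≤ Cardinal.mk κ ∧ y ≤ joinOver A S' := by
  classical
  obtain ⟨f, hf⟩ := hy
  let F : Finset S → L := fun s => ⨆ i ∈ s, A i
  have hF : Monotone F := fun s t hst => iSup₂_le fun i hi => le_iSup₂_of_le i (hst hi) le_rfl
  let g : Finset S → κ := fun s => f ⟨F s ⊓ y, inf_le_right⟩
  let p : κ → Finset S := Function.invFun g
  have hp : ∀ s, F (p (g s)) ⊓ y = F s ⊓ y := fun s => by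
    have : g (p (g s)) = g s := Function.invFun_eq ⟨s, rfl⟩
    exact congrArg Subtype.val (hf this)
  refine ⟨⋃ c, (fun i : S => (i : J)) '' (p c : Set S), ?_, ?_, ?_⟩
  · exact Set.iUnion_subset fun c => by rintro _ ⟨i, -, rfl⟩; exact i.2
  · refine (Cardinal.mk_iUnion_le _).trans ?_
    refine (mul_le_mul' le_rfl (ciSup_le' fun c => ?_)).trans
      (Cardinal.mul_eq_self (Cardinal.aleph0_le_mk κ)).le
    exact (Cardinal.mk_le_aleph0_iff.2 (((p c).finite_toSet.image _).countable)).trans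
      (Cardinal.aleph0_le_mk κ)
  · have hS : joinOver A S = ⨆ s : Finset S, F s := by
      rw [joinOver, iSup_subtype', iSup_eq_iSup_finset]
    rw [← inf_eq_right.2 h, hS]
    refine (hL _ F y hF.directed_le).trans (iSup_le fun s => ?_)
    rw [← hp]
    refine inf_le_left.trans (iSup₂_le fun i hi => le_joinOver ?_)
    exact Set.mem_iUnion.2 ⟨g s, i, hi, rfl⟩

variable [LinearOrder J]

/-- The closure condition on index sets in the Hill lemma. -/
def IsHillClosed (A : J → L) (S : Set J) : Prop :=
  ∀ j ∈ S, A j ⊓ stage ⊥ A j ≤ joinOver A (S ∩ Set.Iio j)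

lemma joinOver_le_stage (A : J → L) (S : Set J) (j : J) :
    joinOver A (S ∩ Set.Iio j) ≤ stage ⊥ A j :=
  joinOver_le fun _ hi => apply_le_stage hi.2

lemma IsHillClosed.union {A : J → L} {S T : Set J} (hS : IsHillClosed A S)
    (hT : IsHillClosed A T) : IsHillClosed A (S ∪ T) := by
  rintro j (hj | hj)
  · exact (hS j hj).trans (joinOver_mono A (Set.inter_subset_inter_left _ Set.subset_union_left))
  · exact (hT j hj).trans (joinOver_mono A (Set.inter_subset_inter_left _ Set.subset_union_right))

lemma IsHillClosed.inter_Iio {A : J → L} {S : Set J} (hS : IsHillClosed A S) (k : J) :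
    IsHillClosed A (S ∩ Set.Iio k) := fun j hj =>
  (hS j hj.1).trans (joinOver_mono A fun _ hi => ⟨⟨hi.1, lt_trans hi.2 hj.2⟩, hi.2⟩)

lemma joinOver_inf_le (hL : IsUpperContinuous.{v} L) (A : J → L) (U : Set J) {y c : L}
    (h : ∀ i ∈ U, joinOver A (U ∩ Set.Iic i) ⊓ y ≤ c) : joinOver A U ⊓ y ≤ c := by
  obtain rfl | hU := U.eq_empty_or_nonempty
  · simp [joinOver]
  have : Nonempty U := hU.to_subtype
  let F : U → L := fun i => joinOver A (U ∩ Set.Iic i.1)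
  have hF : Monotone F := fun i j hij =>
    joinOver_mono A (Set.inter_subset_inter_right _ (Set.Iic_subset_Iic.2 hij))
  have : joinOver A U ≤ ⨆ i, F i :=
    joinOver_le fun i hi => le_iSup_of_le (f := F) ⟨i, hi⟩ (le_joinOver ⟨hi, le_rfl⟩)
  exact (inf_le_inf_right _ this).trans ((hL _ F y hF.directed_le).trans
    (iSup_le fun i => h i i.2))

variable [WellFoundedLT J]

lemma IsHillClosed.joinOver_inf_joinOver_le [IsModularLattice L] (hL : IsUpperContinuous.{v} L)
    {A : J → L} {S D : Set J} (hS : IsHillClosed A S) (hD : IsLowerSet D) :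
    joinOver A S ⊓ joinOver A D ≤ joinOver A (S ∩ D) := by
  refine joinOver_inf_le hL A S fun i hi => ?_
  induction i using WellFoundedLT.induction with
  | _ i ih =>
    by_cases hiD : i ∈ D
    · exact inf_le_left.trans (joinOver_mono A fun l hl => ⟨hl.1, hD hl.2 hiD⟩)
    have h₁ : joinOver A (S ∩ Set.Iio i) ⊓ joinOver A D ≤ joinOver A (S ∩ D) :=
      joinOver_inf_le hL A _ fun l hl => (inf_le_inf_right _
        (joinOver_mono A (Set.inter_subset_inter_left _ Set.inter_subset_left))).trans
          (ih l hl.2 hl.1)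
    have h₂ : joinOver A (S ∩ Set.Iic i) ≤ joinOver A (S ∩ Set.Iio i) ⊔ A i :=
      joinOver_le fun l hl => (lt_or_eq_of_le hl.2).elim
        (fun h => le_sup_of_le_left (le_joinOver ⟨hl.1, h⟩)) fun h => h ▸ le_sup_right
    have h₃ : (joinOver A (S ∩ Set.Iio i) ⊔ A i) ⊓ stage ⊥ A i ≤ joinOver A (S ∩ Set.Iio i) := by
      rw [sup_inf_assoc_of_le _ (joinOver_le_stage A S i)]
      exact sup_le le_rfl (hS i hi)
    have h₄ : joinOver A D ≤ stage ⊥ A i := joinOver_le fun l hl =>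
      apply_le_stage (lt_of_not_ge fun h => hiD (hD h hl))
    calc _ ≤ ((joinOver A (S ∩ Set.Iio i) ⊔ A i) ⊓ stage ⊥ A i) ⊓ joinOver A D :=
          le_inf (le_inf (inf_le_left.trans h₂) (inf_le_right.trans h₄)) inf_le_right
      _ ≤ _ := (inf_le_inf_right _ h₃).trans h₁

/-- The filtration of an interval between the joins over two closed index sets. -/
lemma IsHillClosed.filteredBetween [IsModularLattice L] (hL : IsUpperContinuous.{v} L)
    {R : L → L → Prop} (hR : ∀ x y, R y (x ⊔ y) ↔ R (x ⊓ y) x) {A : J → L}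
    (hA : ∀ j, A j ≤ stage ⊥ A j ∨ R (stage ⊥ A j) (stage ⊥ A j ⊔ A j)) {S T : Set J}
    (hST : S ⊆ T) (hS : IsHillClosed A S) (hT : IsHillClosed A T) :
    FilteredBetween.{v} R (joinOver A S) (joinOver A T) := by
  classical
  let B : J → L := fun j => if j ∈ T then A j else ⊥
  have hBT : ∀ {j}, j ∈ T → B j = A j := fun h => if_pos h
  have hst : ∀ j, stage (joinOver A S) B j = joinOver A (S ∪ T ∩ Set.Iio j) := by
    intro j
    rw [joinOver_union]
    refine le_antisymm (stage_le le_sup_left fun i hi => ?_)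
      (sup_le (le_stage _) (joinOver_le fun i hi => ?_))
    · by_cases hiT : i ∈ T
      · rw [hBT hiT]
        exact le_sup_of_le_right (le_joinOver ⟨hiT, hi⟩)
      · simp [B, hiT]
    · exact (hBT hi.1).ge.trans (apply_le_stage hi.2)
  refine ⟨J, inferInstance, inferInstance, B, le_antisymm ?_ ?_, fun j => ?_⟩
  · refine sup_le (joinOver_mono A hST) (iSup_le fun i => ?_)
    by_cases hiT : i ∈ T
    · exact (hBT hiT).le.trans (le_joinOver hiT)
    · simp [B, hiT]
  · exact joinOver_le fun i hi => le_sup_of_le_right ((hBT hi).ge.trans (le_iSup B i))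
  · rw [hst]
    by_cases hjT : j ∈ T
    swap
    · simp [B, hjT]
    rw [hBT hjT]
    by_cases hjS : j ∈ S
    · exact Or.inl (le_joinOver (Or.inl hjS))
    have hU : IsHillClosed A (S ∪ T ∩ Set.Iio j) := hS.union (hT.inter_Iio j)
    have h₁ : A j ⊓ stage ⊥ A j ≤ joinOver A (S ∪ T ∩ Set.Iio j) :=
      (hT j hjT).trans (joinOver_mono A Set.subset_union_right)
    have h₂ : A j ⊓ joinOver A (S ∪ T ∩ Set.Iio j) ≤ stage ⊥ A j := by
      rw [inf_comm]
      refine (inf_le_inf_left _ (le_joinOver (S := Set.Iic j) le_rfl)).trans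
        ((hU.joinOver_inf_joinOver_le hL (isLowerSet_Iic j)).trans (joinOver_le ?_))
      rintro i ⟨hi, hij⟩
      refine apply_le_stage (lt_of_le_of_ne hij ?_)
      rintro rfl
      exact hi.elim hjS fun h => lt_irrefl _ h.2
    have h₃ : A j ⊓ joinOver A (S ∪ T ∩ Set.Iio j) = A j ⊓ stage ⊥ A j :=
      le_antisymm (le_inf inf_le_left h₂) (le_inf inf_le_left h₁)
    rw [sup_comm, hR, h₃, ← hR, sup_comm (A j)]
    refine (hA j).imp_left fun h => ?_
    exact (le_inf le_rfl h).trans h₁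

end Hill

end Lattice

section SubobjectElements

section Abelian

variable {K : Type u} [Category.{v} K]

lemma subobject_le_iff_factors {X : K} {x y : Subobject X} :
    x ≤ y ↔ ∀ (T : K) (t : T ⟶ X), x.Factors t → y.Factors t :=
  ⟨fun h _ t ht => Subobject.factors_of_le t h ht,
    fun h => Subobject.le_of_factors (h _ _ (Subobject.factors_self x))⟩

variable [Abelian K] {X : K}

lemma factors_iff_comp_cokernel_π (z : Subobject X) {T : K} (t : T ⟶ X) :
    z.Factors t ↔ t ≫ cokernel.π z.arrow = 0 := by
  constructor
  · intro h
    rw [← z.factorThru_arrow t h, assoc, cokernel.condition, comp_zero]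
  · intro h
    have := Subobject.factors_comp_arrow (P := z) (Abelian.monoLift z.arrow t h)
    rwa [Abelian.monoLift_comp] at this

lemma factors_epi_comp_iff (z : Subobject X) {T T' : K} (e : T' ⟶ T) [Epi e] (t : T ⟶ X) :
    z.Factors (e ≫ t) ↔ z.Factors t := by
  rw [factors_iff_comp_cokernel_π, factors_iff_comp_cokernel_π, assoc]
  exact ⟨fun h => by rwa [← cancel_epi e, comp_zero], fun h => by rw [h, comp_zero]⟩

lemma imageSubobject_factors_iff {B : K} (f : B ⟶ X) {T : K} (t : T ⟶ X) :
    (imageSubobject f).Factors t ↔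
      ∃ (T' : K) (e : T' ⟶ T) (_ : Epi e) (s : T' ⟶ B), e ≫ t = s ≫ f := by
  constructor
  · intro h
    refine ⟨_, pullback.snd (factorThruImageSubobject f) ((imageSubobject f).factorThru t h),
      inferInstance, pullback.fst _ _, ?_⟩
    have := pullback.condition (f := factorThruImageSubobject f)
      (g := (imageSubobject f).factorThru t h) =≫ (imageSubobject f).arrow
    simpa using this.symm
  · rintro ⟨T', e, _, s, h⟩
    rw [← factors_epi_comp_iff _ e, h]
    exact imageSubobject_factors_comp_self f s

lemma sup_factors_iff (x y : Subobject X) {T : K} (t : T ⟶ X) :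
    (x ⊔ y).Factors t ↔ ∃ (T' : K) (e : T' ⟶ T) (_ : Epi e) (a b : T' ⟶ X),
      x.Factors a ∧ y.Factors b ∧ e ≫ t = a + b := by
  constructor
  · intro h
    have hle : x ⊔ y ≤ imageSubobject (biprod.desc x.arrow y.arrow) := by
      refine sup_le (Subobject.le_of_factors ?_) (Subobject.le_of_factors ?_)
      · simpa using imageSubobject_factors_comp_self (biprod.desc x.arrow y.arrow) biprod.inl
      · simpa using imageSubobject_factors_comp_self (biprod.desc x.arrow y.arrow) biprod.inr
    obtain ⟨T', e, he, s, hs⟩ :=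
      (imageSubobject_factors_iff _ t).1 (Subobject.factors_of_le t hle h)
    refine ⟨T', e, he, (s ≫ biprod.fst) ≫ x.arrow, (s ≫ biprod.snd) ≫ y.arrow,
      Subobject.factors_comp_arrow _, Subobject.factors_comp_arrow _, ?_⟩
    rw [hs, biprod.desc_eq, Preadditive.comp_add, assoc, assoc]
  · rintro ⟨T', e, _, a, b, ha, hb, h⟩
    rw [← factors_epi_comp_iff _ e, h]
    exact Subobject.factors_add _ _ (Subobject.sup_factors_of_factors_left ha)
      (Subobject.sup_factors_of_factors_right hb)

instance isModularLattice_subobject : IsModularLattice (Subobject X) where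
  sup_inf_le_assoc_of_le {x} y {z} hxz := by
    rw [subobject_le_iff_factors]
    intro T t ht
    obtain ⟨h, hz⟩ := (Subobject.inf_factors t).1 ht
    obtain ⟨T', e, _, a, b, ha, hb, h⟩ := (sup_factors_iff _ _ _).1 h
    refine (sup_factors_iff _ _ _).2 ⟨T', e, inferInstance, a, b, ha,
      (Subobject.inf_factors b).2 ⟨hb, ?_⟩, h⟩
    have : z.Factors (e ≫ t) := Subobject.factors_of_factors_right e hz
    rw [h] at this
    exact Subobject.factors_right_of_factors_add a b this (Subobject.factors_of_le a hxz ha)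

end Abelian

section Grothendieck

variable {K : Type u} [Category.{v} K] [Abelian K] [IsGrothendieckAbelian.{v} K]

lemma factors_comp_colimit_desc {ι : Type v} [SmallCategory ι] [IsFiltered ι] {X : K}
    {G : ι ⥤ K} (α : G ⟶ (Functor.const ι).obj X) {y w : Subobject X}
    (h : ∀ (i : ι) (T : K) (t : T ⟶ G.obj i), y.Factors (t ≫ α.app i) → w.Factors (t ≫ α.app i))
    {T : K} (s : T ⟶ colimit G) (hs : y.Factors (s ≫ colimit.desc G ⟨X, α⟩)) :
    w.Factors (s ≫ colimit.desc G ⟨X, α⟩) := by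
  have : CategoryTheory.IsConnected ι := IsFiltered.isConnected ι
  let β : (Functor.const ι).obj (y : K) ⟶ (Functor.const ι).obj X :=
    (Functor.const ι).map y.arrow
  have hp := IsPullback.of_hasPullback α β
  have hcolim := Functor.map_isPullback colim hp
  let p : colimit G ⟶ X := colimit.desc G ⟨X, α⟩
  let κ : colimit ((Functor.const ι).obj X) ⟶ X :=
    ((colimit.isColimit ((Functor.const ι).obj X)).coconePointUniqueUpToIso
      (isColimitConstCocone ι X)).hom
  have : IsIso κ := Iso.isIso_hom _
  have hκ : ∀ i, colimit.ι ((Functor.const ι).obj X) i ≫ κ = 𝟙 X := fun i =>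
    (colimit.isColimit ((Functor.const ι).obj X)).comp_coconePointUniqueUpToIso_hom
      (isColimitConstCocone ι X) i
  have hακ : colim.map α ≫ κ = p := by
    refine colimit.hom_ext fun i => ?_
    rw [colim_map, ι_colimMap_assoc, hκ]
    simp [p]
  change y.Factors (s ≫ p) at hs
  change w.Factors (s ≫ p)
  let i₀ : ι := Classical.choice IsFiltered.nonempty
  have hcomm : s ≫ colim.map α =
      (y.factorThru _ hs ≫ colimit.ι ((Functor.const ι).obj (y : K)) i₀) ≫ colim.map β := by
    rw [← cancel_mono κ, assoc, hακ, assoc, assoc, colim_map, ι_colimMap_assoc, hκ]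
    simp [β]
  have hfac : s = hcolim.lift _ _ hcomm ≫ colim.map (pullback.fst α β) :=
    (hcolim.lift_fst _ _ hcomm).symm
  rw [hfac, assoc]
  refine Subobject.factors_of_factors_right _ ?_
  rw [factors_iff_comp_cokernel_π]
  refine colimit.hom_ext fun i => ?_
  have hw := h i _ ((pullback.fst α β).app i) (by
    have := congr_arg (fun φ => NatTrans.app φ i) hp.w
    dsimp [β] at this
    rw [this]
    exact Subobject.factors_comp_arrow _)
  rw [factors_iff_comp_cokernel_π, assoc] at hw
  simpa [p] using hw

lemma isUpperContinuous_subobject (X : K) : IsUpperContinuous.{v} (Subobject X) := by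
  intro ι _ f y hdir
  let _ : Preorder ι := Preorder.lift f
  have hf : Monotone f := fun _ _ h => h
  have : IsDirectedOrder ι := ⟨fun a b => hdir a b⟩
  let G : ι ⥤ K := hf.functor ⋙ Subobject.underlying
  let α : G ⟶ (Functor.const ι).obj X :=
    { app := fun j => (f j).arrow
      naturality := fun i j g => (Subobject.underlying_arrow _).trans (comp_id _).symm }
  have hle : ⨆ i, f i ≤ imageSubobject (colimit.desc G ⟨X, α⟩) :=
    iSup_le fun i => Subobject.le_of_factors (by
      have := imageSubobject_factors_comp_self (colimit.desc G ⟨X, α⟩) (colimit.ι G i)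
      rwa [colimit.ι_desc] at this)
  rw [subobject_le_iff_factors]
  intro T t ht
  obtain ⟨h1, h2⟩ := (Subobject.inf_factors t).1 ht
  obtain ⟨T', e, _, s, hs⟩ :=
    (imageSubobject_factors_iff _ t).1 (Subobject.factors_of_le t hle h1)
  rw [← factors_epi_comp_iff _ e, hs]
  refine factors_comp_colimit_desc α (y := y) (fun i T t ht => ?_) s ?_
  · exact Subobject.factors_of_le _ (le_iSup (fun i => f i ⊓ y) i)
      ((Subobject.inf_factors _).2 ⟨Subobject.factors_comp_arrow (P := f i) t, ht⟩)
  · rw [← hs]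
    exact Subobject.factors_of_factors_right e h2

end Grothendieck

end SubobjectElements

section Quotients

variable {K : Type u} [Category.{v} K] [Abelian K] {X : K}

/-- `e` is the quotient of its source `B` by the inverse image of `a` along `m : B ⟶ X`. -/
def IsQuotientBy (a : Subobject X) {B Q : K} (m : B ⟶ X) (e : B ⟶ Q) : Prop :=
  Epi e ∧ ∀ (T : K) (t : T ⟶ B), t ≫ e = 0 ↔ a.Factors (t ≫ m)

lemma exists_isQuotientBy (a : Subobject X) {B : K} (m : B ⟶ X) :
    ∃ (Q : K) (e : B ⟶ Q), IsQuotientBy a m e :=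
  ⟨_, cokernel.π ((Subobject.pullback m).obj a).arrow, inferInstance, fun _ t => by
    rw [← factors_iff_comp_cokernel_π, pullback_factors_iff]⟩

lemma IsQuotientBy.nonempty_iso {a : Subobject X} {B Q Q' : K} {m : B ⟶ X} {e : B ⟶ Q}
    {e' : B ⟶ Q'} (h : IsQuotientBy a m e) (h' : IsQuotientBy a m e') : Nonempty (Q ≅ Q') := by
  have := h.1
  have := h'.1
  have w : kernel.ι e ≫ e' = 0 := (h'.2 _ _).2 ((h.2 _ _).1 (kernel.condition e))
  have w' : kernel.ι e' ≫ e = 0 := (h.2 _ _).2 ((h'.2 _ _).1 (kernel.condition e'))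
  exact ⟨⟨Abelian.epiDesc e e' w, Abelian.epiDesc e' e w', by simp [← cancel_epi e],
    by simp [← cancel_epi e']⟩⟩

lemma IsQuotientBy.epi_comp {a : Subobject X} {B B' Q : K} {m : B ⟶ X} {e : B ⟶ Q}
    (h : IsQuotientBy a m e) (p : B' ⟶ B) [Epi p] : IsQuotientBy a (p ≫ m) (p ≫ e) :=
  have := h.1
  ⟨CategoryTheory.epi_comp _ _, fun T t => by rw [← assoc, h.2, assoc]⟩

lemma IsQuotientBy.comp_iso {a : Subobject X} {B Q Q' : K} {m : B ⟶ X} {e : B ⟶ Q}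
    (h : IsQuotientBy a m e) (i : Q ≅ Q') : IsQuotientBy a m (e ≫ i.hom) :=
  have := h.1
  ⟨CategoryTheory.epi_comp _ _, fun T t => by
    rw [← h.2, ← assoc, Preadditive.IsIso.comp_right_eq_zero]⟩

lemma isQuotientBy_cokernel_π {A B : K} (f : A ⟶ B) [Mono f] (m : B ⟶ X) [Mono m] :
    IsQuotientBy (Subobject.mk (f ≫ m)) m (cokernel.π f) := by
  refine ⟨inferInstance, fun T t => ⟨fun h => ?_, fun h => ?_⟩⟩
  · rw [← Abelian.monoLift_comp f t h, assoc]
    exact Subobject.factors_of_factors_right _ (Subobject.mk_factors_self _)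
  · obtain ⟨s, hs⟩ : ∃ s : T ⟶ A, s ≫ f ≫ m = t ≫ m := (Subobject.mk_factors_iff _ _).1 h
    rw [← assoc, cancel_mono] at hs
    rw [← hs, assoc, cokernel.condition, comp_zero]

lemma imageSubobject_of_epi {A B : K} (f : A ⟶ B) [Epi f] : imageSubobject f = ⊤ :=
  top_le_iff.1 (subobject_le_iff_factors.2 fun _ t _ => (imageSubobject_factors_iff f t).2
    ⟨_, pullback.snd f t, inferInstance, pullback.fst f t, pullback.condition.symm⟩)

/-- The relation `a ≤ b` for subobjects whose quotient is isomorphic to a member of `S`. -/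
def QuotientRel (S : Set K) (a b : Subobject X) : Prop :=
  a ≤ b ∧ ∃ s ∈ S, ∃ e : (b : K) ⟶ s, IsQuotientBy a b.arrow e

lemma IsQuotientBy.quotientRel_iff {S : Set K} {a b : Subobject X} {B Q : K} {m : B ⟶ X}
    {e : B ⟶ Q} (h : IsQuotientBy a m e) (hb : imageSubobject m = b) (hab : a ≤ b) :
    QuotientRel S a b ↔ ∃ s ∈ S, Nonempty (Q ≅ s) := by
  subst hb
  have key : ∀ {Q'} {e' : (imageSubobject m : K) ⟶ Q'},
      IsQuotientBy a (imageSubobject m).arrow e' → Nonempty (Q ≅ Q') := fun h' => by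
    have := h'.epi_comp (factorThruImageSubobject m)
    rw [imageSubobject_arrow_comp] at this
    exact h.nonempty_iso this
  constructor
  · rintro ⟨-, s, hs, e', h'⟩
    exact ⟨s, hs, key h'⟩
  · rintro ⟨s, hs, ⟨i⟩⟩
    obtain ⟨Q', e', h'⟩ := exists_isQuotientBy a (imageSubobject m).arrow
    obtain ⟨i'⟩ := key h'
    exact ⟨hab, s, hs, _, h'.comp_iso (i'.symm ≪≫ i)⟩

lemma imageSubobject_subobject_arrow (b : Subobject X) : imageSubobject b.arrow = b := by
  rw [imageSubobject_mono, Subobject.mk_arrow]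

lemma IsQuotientBy.ofLE_sup {x y : Subobject X} {Q : K} {e : ((x ⊔ y : Subobject X) : K) ⟶ Q}
    (h : IsQuotientBy y (x ⊔ y).arrow e) :
    IsQuotientBy (x ⊓ y) x.arrow (Subobject.ofLE x (x ⊔ y) le_sup_left ≫ e) := by
  have hx := Subobject.ofLE_arrow (le_sup_left : x ≤ x ⊔ y)
  have hy := Subobject.ofLE_arrow (le_sup_right : y ≤ x ⊔ y)
  have := h.1
  refine ⟨Preadditive.epi_of_cancel_zero _ fun g hg => ?_, fun T t => ?_⟩
  · have hye : Subobject.ofLE y (x ⊔ y) le_sup_right ≫ e = 0 := by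
      rw [h.2, hy]
      exact Subobject.factors_self y
    obtain ⟨T', c, _, a, b, ha, hb, hc⟩ :=
      (sup_factors_iff x y _).1 (Subobject.factors_self (x ⊔ y))
    have : c = x.factorThru a ha ≫ Subobject.ofLE x (x ⊔ y) le_sup_left +
        y.factorThru b hb ≫ Subobject.ofLE y (x ⊔ y) le_sup_right := by
      rw [← cancel_mono (x ⊔ y).arrow, hc, Preadditive.add_comp, assoc, assoc, hx, hy]
      simp
    rw [← cancel_epi e, ← cancel_epi c, this, Preadditive.add_comp, assoc, assoc,
      reassoc_of% hye, ← assoc _ e g, hg]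
    simp
  · rw [← assoc, h.2, assoc, hx, Subobject.inf_factors]
    exact ⟨fun h => ⟨Subobject.factors_comp_arrow t, h⟩, fun h => h.2⟩

lemma quotientRel_sup_iff (S : Set K) (x y : Subobject X) :
    QuotientRel S y (x ⊔ y) ↔ QuotientRel S (x ⊓ y) x := by
  obtain ⟨Q, e, h⟩ := exists_isQuotientBy y (x ⊔ y).arrow
  rw [h.quotientRel_iff (imageSubobject_subobject_arrow _) le_sup_right,
    h.ofLE_sup.quotientRel_iff (imageSubobject_subobject_arrow _) inf_le_left]

end Quotients

section Image

variable {K : Type u} [Category.{v} K] [Abelian K] {B Y : K} (f : B ⟶ Y)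

/-- The image of a subobject along a morphism. -/
noncomputable def imageAlong (z : Subobject B) : Subobject Y := imageSubobject (z.arrow ≫ f)

variable {f}

lemma imageAlong_factors_iff {z : Subobject B} {T : K} (t : T ⟶ Y) :
    (imageAlong f z).Factors t ↔ ∃ (T' : K) (e : T' ⟶ T) (_ : Epi e) (s : T' ⟶ B),
      z.Factors s ∧ e ≫ t = s ≫ f := by
  rw [imageAlong, imageSubobject_factors_iff]
  constructor
  · rintro ⟨T', e, he, s, h⟩
    exact ⟨T', e, he, s ≫ z.arrow, Subobject.factors_comp_arrow s, by rw [h, assoc]⟩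
  · rintro ⟨T', e, he, s, hs, h⟩
    exact ⟨T', e, he, z.factorThru s hs, by rw [h, ← assoc, Subobject.factorThru_arrow]⟩

lemma imageAlong_factors {z : Subobject B} {T : K} {t : T ⟶ B} (h : z.Factors t) :
    (imageAlong f z).Factors (t ≫ f) :=
  (imageAlong_factors_iff _).2 ⟨T, 𝟙 T, inferInstance, t, h, id_comp _⟩

lemma imageAlong_le_iff {z : Subobject B} {w : Subobject Y} :
    imageAlong f z ≤ w ↔ z ≤ (Subobject.pullback f).obj w := by
  constructor
  · intro h
    refine Subobject.le_of_factors ((pullback_factors_iff _ _ _).2 ?_)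
    exact Subobject.factors_of_le _ h (imageAlong_factors (Subobject.factors_self z))
  · intro h
    rw [subobject_le_iff_factors]
    intro T t ht
    obtain ⟨T', e, _, s, hs, hst⟩ := (imageAlong_factors_iff t).1 ht
    rw [← factors_epi_comp_iff w e, hst, ← pullback_factors_iff]
    exact Subobject.factors_of_le _ h hs

lemma gc_imageAlong : GaloisConnection (imageAlong f) (Subobject.pullback f).obj :=
  fun _ _ => imageAlong_le_iff

lemma imageSubobject_le_iff {B X : K} {g : B ⟶ X} {z : Subobject X} :
    imageSubobject g ≤ z ↔ z.Factors g := by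
  refine ⟨fun h => Subobject.factors_of_le g h ?_,
    fun h => imageSubobject_le g (z.factorThru g h) (z.factorThru_arrow g h)⟩
  simpa using imageSubobject_factors_comp_self g (𝟙 B)

lemma imageAlong_imageSubobject {A : K} (g : A ⟶ B) :
    imageAlong f (imageSubobject g) = imageSubobject (g ≫ f) :=
  eq_of_forall_ge_iff fun w => by
    rw [imageAlong_le_iff, imageSubobject_le_iff, imageSubobject_le_iff, pullback_factors_iff]

lemma imageAlong_top : imageAlong f ⊤ = imageSubobject f :=
  eq_of_forall_ge_iff fun w => by
    rw [imageAlong_le_iff, imageSubobject_le_iff]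
    refine ⟨fun h => ?_, fun h => Subobject.le_of_factors ?_⟩
    · have := Subobject.factors_of_le (𝟙 B) h (Subobject.top_factors _)
      rwa [pullback_factors_iff, id_comp] at this
    · rw [pullback_factors_iff]
      exact Subobject.factors_of_factors_right _ h

lemma imageAlong_pullback {w : Subobject Y} (hw : w ≤ imageAlong f ⊤) :
    imageAlong f ((Subobject.pullback f).obj w) = w := by
  refine le_antisymm (imageAlong_le_iff.2 le_rfl) (subobject_le_iff_factors.2 fun T t ht => ?_)
  obtain ⟨T', e, he, s, -, hst⟩ :=
    (imageAlong_factors_iff t).1 (Subobject.factors_of_le t hw ht)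
  refine (imageAlong_factors_iff t).2 ⟨T', e, he, s, ?_, hst⟩
  rw [pullback_factors_iff, ← hst]
  exact Subobject.factors_of_factors_right e ht

lemma factors_of_imageAlong_factors {z : Subobject B}
    (hz : ∀ (T : K) (t : T ⟶ B), t ≫ f = 0 → z.Factors t) {T : K} {t : T ⟶ B}
    (ht : (imageAlong f z).Factors (t ≫ f)) : z.Factors t := by
  obtain ⟨T', e, _, s, hs, hst⟩ := (imageAlong_factors_iff _).1 ht
  rw [← factors_epi_comp_iff z e, ← sub_add_cancel (e ≫ t) s]
  exact Subobject.factors_add _ _ (hz _ _ (by rw [Preadditive.sub_comp, assoc, hst, sub_self])) hs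

lemma le_of_imageAlong_le {z z' : Subobject B}
    (hz : ∀ (T : K) (t : T ⟶ B), t ≫ f = 0 → z.Factors t)
    (h : imageAlong f z' ≤ imageAlong f z) : z' ≤ z :=
  subobject_le_iff_factors.2 fun _ _ ht =>
    factors_of_imageAlong_factors hz (Subobject.factors_of_le _ h (imageAlong_factors ht))

lemma quotientRel_imageAlong_iff (S : Set K) {z z' : Subobject B}
    (hz : ∀ (T : K) (t : T ⟶ B), t ≫ f = 0 → z.Factors t) (hzz' : z ≤ z') :
    QuotientRel S (imageAlong f z) (imageAlong f z') ↔ QuotientRel S z z' := by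
  obtain ⟨Q, e, h⟩ := exists_isQuotientBy z z'.arrow
  have h' : IsQuotientBy (imageAlong f z) (z'.arrow ≫ f) e := by
    refine ⟨h.1, fun T t => ?_⟩
    rw [h.2, ← assoc]
    exact ⟨imageAlong_factors, factors_of_imageAlong_factors hz⟩
  rw [h.quotientRel_iff (imageSubobject_subobject_arrow _) hzz',
    h'.quotientRel_iff (b := imageAlong f z') rfl (gc_imageAlong.monotone_l hzz')]

end Image

section Grothendieck

variable {K : Type u} [Category.{v} K] [Abelian K] [IsGrothendieckAbelian.{v} K]

lemma filteredBetween_imageAlong_iff (S : Set K) {B Y : K} {f : B ⟶ Y} {a b : Subobject B}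
    (ha : ∀ (T : K) (t : T ⟶ B), t ≫ f = 0 → a.Factors t) (hab : a ≤ b) :
    FilteredBetween.{v} (QuotientRel S) (imageAlong f a) (imageAlong f b) ↔
      FilteredBetween.{v} (QuotientRel S) a b := by
  have ha' : ∀ s, a ≤ s → ∀ (T : K) (t : T ⟶ B), t ≫ f = 0 → s.Factors t :=
    fun s hs T t ht => Subobject.factors_of_le t hs (ha T t ht)
  constructor
  · refine FilteredBetween.comap (fun _ _ => gc_imageAlong.l_sup) (fun _ => gc_imageAlong.l_iSup)
      (fun s t hs h => le_of_imageAlong_le (ha' s hs) h)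
      (fun s t hs hst h => (quotientRel_imageAlong_iff S (ha' s hs) hst).1 h) hab
      (fun s hs => ⟨_, imageAlong_pullback (hs.trans (gc_imageAlong.monotone_l le_top))⟩)
  · refine FilteredBetween.map (fun _ _ => gc_imageAlong.l_sup) (fun _ => gc_imageAlong.l_iSup)
      (fun s t hs h => (quotientRel_imageAlong_iff S (ha' s hs) h.1).2 h)

lemma IsQuotientBy.filteredBetween_iff (S : Set K) {X B Q : K} {a b : Subobject X} {m : B ⟶ X}
    {e : B ⟶ Q} (h : IsQuotientBy a m e) (hb : imageSubobject m = b) (hab : a ≤ b) :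
    FilteredBetween.{v} (QuotientRel S) a b ↔
      FilteredBetween.{v} (QuotientRel S) (⊥ : Subobject Q) ⊤ := by
  have := h.1
  have htop : imageAlong m ⊤ = b := imageAlong_top.trans hb
  have h1 : imageAlong m ((Subobject.pullback m).obj a) = a :=
    imageAlong_pullback (hab.trans htop.ge)
  have h2 : imageAlong e ((Subobject.pullback m).obj a) = ⊥ := by
    refine le_bot_iff.1 (imageAlong_le_iff.2 (subobject_le_iff_factors.2 fun T t ht => ?_))
    rw [pullback_factors_iff] at ht ⊢
    rw [(h.2 T t).2 ht]
    exact Subobject.factors_zero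
  have h3 : imageAlong e ⊤ = ⊤ := imageAlong_top.trans (imageSubobject_of_epi e)
  conv_lhs => rw [← h1, ← htop]
  rw [← h2, ← h3, filteredBetween_imageAlong_iff S _ le_top,
    filteredBetween_imageAlong_iff S _ le_top]
  · intro T t ht
    rw [pullback_factors_iff]
    exact (h.2 T t).1 ht
  · intro T t ht
    rw [pullback_factors_iff, ht]
    exact Subobject.factors_zero

end Grothendieck

section Filtrations

variable {K : Type u} [Category.{v} K] [Abelian K]

lemma factors_of_isColimit {ι : Type w} [Category ι] {G : ι ⥤ K} {c : Cocone G}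
    (hc : IsColimit c) {X : K} (m : c.pt ⟶ X) {z : Subobject X}
    (h : ∀ i, z.Factors (c.ι.app i ≫ m)) : z.Factors m := by
  rw [factors_iff_comp_cokernel_π]
  refine hc.hom_ext fun i => ?_
  have := h i
  rwa [factors_iff_comp_cokernel_π, assoc, ← comp_zero] at this

variable [IsGrothendieckAbelian.{v} K]

lemma mono_map_of_chain {J : Type v} [LinearOrder J] [SuccOrder J] [WellFoundedLT J]
    (F : J ⥤ K) (hsucc : ∀ j : J, ¬IsMax j → Mono (F.map (homOfLE (Order.le_succ j))))
    (hlim : ∀ j : J, Order.IsSuccLimit j → Nonempty (IsColimit (coconeLT F j)))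
    {i j : J} (f : i ⟶ j) : Mono (F.map f) := by
  induction j using SuccOrder.limitRecOn generalizing i with
  | isMin j hj =>
    obtain rfl : i = j := hj.eq_of_le (leOfHom f)
    rw [Subsingleton.elim f (𝟙 i), F.map_id]
    infer_instance
  | succ j hj ih =>
    obtain hi | rfl := (leOfHom f).lt_or_eq
    · have hij := (Order.lt_succ_iff_of_not_isMax hj).1 hi
      rw [Subsingleton.elim f (homOfLE hij ≫ homOfLE (Order.le_succ j)), F.map_comp]
      have := ih (homOfLE hij)
      have := hsucc j hj
      exact mono_comp _ _
    · rw [Subsingleton.elim f (𝟙 _), F.map_id]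
      infer_instance
  | isSuccLimit j hj ih =>
    obtain hi | rfl := (leOfHom f).lt_or_eq
    · obtain ⟨hc⟩ := hlim j hj
      have : Nonempty {i : J // i < j} := ⟨⟨i, hi⟩⟩
      have : ∀ (a b : {i : J // i < j}) (φ : a ⟶ b), Mono ((restrictionLT F j).map φ) :=
        fun a b φ => ih b.1 b.2 (homOfLE (leOfHom φ))
      exact hc.mono_ι_app_of_isFiltered ⟨i, hi⟩
    · rw [Subsingleton.elim f (𝟙 _), F.map_id]
      infer_instance

/-- An `S`-filtered object has a filtration by subobjects with successive quotients in `S`. -/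
lemma filteredBetween_of_mem_filteredBy {S : Set K} {X : K} (hX : X ∈ filteredBy S) :
    FilteredBetween.{v} (QuotientRel S) (⊥ : Subobject X) ⊤ := by
  obtain ⟨J, _, _, _, _, F, c, hc, eA, eB, hsucc, hlim, -⟩ := hX
  have hmono : ∀ (i j : J) (f : i ⟶ j), Mono (F.map f) := fun i j f =>
    mono_map_of_chain F (fun j hj => (hsucc j hj).1) hlim f
  have : ∀ j, Mono (c.ι.app j) := fun j => hc.mono_ι_app_of_isFiltered j
  let m : ∀ j, F.obj j ⟶ X := fun j => c.ι.app j ≫ eB.hom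
  have hm : ∀ {i j : J} (f : i ⟶ j), F.map f ≫ m j = m i := fun f => by simp [m]
  have : ∀ j, Mono (m j) := fun j => mono_comp _ _
  let x : J → Subobject X := fun j => Subobject.mk (m j)
  have hx : Monotone x := fun i j hij => Subobject.mk_le_mk_of_comm (F.map (homOfLE hij)) (hm _)
  let A : J → Subobject X := fun j => x (Order.succ j)
  have hA : ∀ j, x j ≤ A j := fun j => hx (Order.le_succ j)
  have hst : ∀ j, stage ⊥ A j = x j := by
    intro j
    refine le_antisymm (stage_le bot_le fun i hi => hx (Order.succ_le_of_lt hi)) ?_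
    induction j using SuccOrder.limitRecOn with
    | isMin j hj =>
      obtain rfl := hj.eq_bot
      refine (Subobject.le_of_factors ?_ : x ⊥ ≤ ⊥).trans bot_le
      have : (x ⊥).arrow = 0 := by
        rw [← cancel_epi (Subobject.underlyingIso (m ⊥)).inv, Subobject.underlyingIso_arrow,
          comp_zero, ← cancel_epi eA.hom]
        exact (isZero_zero K).eq_of_src _ _
      rw [this]
      exact Subobject.factors_zero
    | succ j hj ih => exact apply_le_stage (A := A) (Order.lt_succ_of_not_isMax hj)
    | isSuccLimit j hj ih =>
      obtain ⟨h⟩ := hlim j hj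
      refine subobject_le_iff_factors.2 fun T t ht => ?_
      have : (stage ⊥ A j).Factors (m j) := factors_of_isColimit h (m j) fun i => by
        refine Subobject.factors_of_le (P := x i) _ ((hA i).trans (apply_le_stage i.2)) ?_
        have : (coconeLT F j).ι.app i ≫ m j = m i := hm _
        rw [this]
        exact (Subobject.mk_factors_self (m i.1) :)
      refine Subobject.factors_of_le t (Subobject.mk_le_of_comm
        ((stage ⊥ A j).factorThru _ this) (by simp)) ht
  refine ⟨J, inferInstance, inferInstance, A, ?_, fun j => ?_⟩
  · rw [bot_sup_eq, ← top_le_iff]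
    have : (⨆ j, A j).Factors eB.hom := factors_of_isColimit hc _ fun j =>
      Subobject.factors_of_le _ ((hA j).trans (le_iSup A j)) (Subobject.mk_factors_self (m j))
    rw [subobject_le_iff_factors]
    intro T t _
    rw [← comp_id t, ← eB.inv_hom_id, ← assoc]
    exact Subobject.factors_of_factors_right _ this
  · rw [hst, sup_eq_right.2 (hA j)]
    by_cases hj : IsMax j
    · exact Or.inl (hx hj.succ_eq.le)
    · obtain ⟨hmj, s, hs, ⟨i⟩⟩ := hsucc j hj
      have := isQuotientBy_cokernel_π (F.map (homOfLE (Order.le_succ j))) (m (Order.succ j))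
      simp only [hm] at this
      exact Or.inr ((this.quotientRel_iff (imageSubobject_mono _) (hA j)).2 ⟨s, hs, ⟨i⟩⟩)

end Filtrations

section Chains

variable {K : Type u} [Category.{v} K] [Abelian K]

/-- The chain of objects underlying a monotone family of subobjects. -/
noncomputable def subobjectChain {X : K} {J : Type v} [Preorder J] {V : J → Subobject X}
    (hV : Monotone V) : J ⥤ K :=
  hV.functor ⋙ Subobject.underlying

/-- Functors preserving colimits and monomorphisms preserve filtered objects. -/
lemma map_mem_filteredBy {M : Type u'} [Category.{v} M] [Abelian M] (Φ : K ⥤ M)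
    [PreservesColimitsOfSize.{v, v} Φ] [PreservesFiniteColimits Φ] [Φ.PreservesMonomorphisms]
    [Φ.PreservesZeroMorphisms] {S : Set K} {S' : Set M} (hS : ∀ s ∈ S, Φ.obj s ∈ S') {X : K}
    (hX : X ∈ filteredBy S) : Φ.obj X ∈ filteredBy S' := by
  obtain ⟨J, _, _, _, _, F, c, hc, eA, eB, hsucc, hlim, -⟩ := hX
  refine ⟨J, inferInstance, inferInstance, inferInstance, inferInstance, F ⋙ Φ, Φ.mapCocone c,
    isColimitOfPreserves Φ hc, ((Φ.map_isZero (isZero_zero K)).isoZero).symm ≪≫ Φ.mapIso eA,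
    Φ.mapIso eB, fun j hj => ?_, fun j hj => ?_, (isZero_zero M).eq_of_src _ _⟩
  · obtain ⟨hm, s, hs, ⟨i⟩⟩ := hsucc j hj
    exact ⟨inferInstanceAs (Mono (Φ.map _)), _, hS s hs,
      ⟨(PreservesCokernel.iso Φ (F.map (homOfLE (Order.le_succ j)))).symm ≪≫ Φ.mapIso i⟩⟩
  · obtain ⟨h⟩ := hlim j hj
    exact ⟨isColimitOfPreserves Φ h⟩

variable [IsGrothendieckAbelian.{v} K]

lemma nonempty_isColimit_coconeLT {X : K} {J : Type v} [LinearOrder J] {V : J → Subobject X}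
    (hV : Monotone V) (j : J) [Nonempty {i // i < j}] (hj : V j = ⨆ i : {i // i < j}, V i) :
    Nonempty (IsColimit (coconeLT (subobjectChain hV) j)) := by
  let F : {i // i < j} ⥤ MonoOver X :=
    (Monotone.functor (f := fun i : {i : J // i < j} => V i) fun _ _ h => hV h) ⋙
      Subobject.representative
  let c : Cocone (F ⋙ MonoOver.forget X) :=
    { pt := Over.mk (V j).arrow
      ι :=
        { app := fun i => Over.homMk (Subobject.ofLE (V i) (V j) (hV i.2.le))
            (Subobject.ofLE_arrow _)
          naturality := fun _ _ _ => by
            ext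
            exact (cancel_mono (V j).arrow).1 ((Over.w _).trans (Over.w _).symm) } }
  have : Mono c.pt.hom := inferInstanceAs (Mono (V j).arrow)
  have h : Subobject.mk c.pt.hom = ⨆ i, Subobject.mk (F.obj i).obj.hom := by
    change Subobject.mk (V j).arrow = ⨆ i : {i // i < j}, Subobject.mk (V i).arrow
    simp only [Subobject.mk_arrow, hj]
  exact ⟨IsGrothendieckAbelian.isColimitMapCoconeOfSubobjectMkEqISup F c h⟩

open ZeroObject in
/-- An object with a filtration by subobjects with successive quotients in `S` is `S`-filtered. -/
lemma mem_filteredBy_of_filteredBetween {S : Set K} {X : K}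
    (h : FilteredBetween.{v} (QuotientRel S) (⊥ : Subobject X) ⊤) : X ∈ filteredBy S := by
  obtain ⟨J, _, _, A, htop, hA⟩ := h.exists_strict
  let _ : SuccOrder (WithTop J) := SuccOrder.ofLinearWellFoundedLT _
  let _ : OrderBot (WithTop J) := WellFoundedLT.toOrderBot _
  let V : WithTop J → Subobject X := fun j => ⨆ i : {i : J // (i : WithTop J) < j}, A i
  have hV : Monotone V := fun j j' h =>
    iSup_le fun i => le_iSup_of_le (⟨i.1, i.2.trans_le h⟩ : {i : J // (i : WithTop J) < j'}) le_rfl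
  have hAV : ∀ {i : J} {j : WithTop J}, (i : WithTop J) < j → A i ≤ V j := fun {i j} h =>
    le_iSup (fun i : {i : J // (i : WithTop J) < j} => A i) ⟨i, h⟩
  have hVbot : V ⊥ = ⊥ := le_bot_iff.1 (iSup_le fun i => (not_lt_bot i.2).elim)
  have hVtop : V ⊤ = ⊤ := top_le_iff.1 (by
    rw [← htop, bot_sup_eq]
    exact iSup_le fun j => hAV (WithTop.coe_lt_top j))
  have hVcoe : ∀ j : J, V j = stage ⊥ A j := fun j => le_antisymm
    (iSup_le fun i => apply_le_stage (WithTop.coe_lt_coe.1 i.2))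
    (stage_le bot_le fun i hi => hAV (WithTop.coe_lt_coe.2 hi))
  have hmax : ∀ j : J, ¬ IsMax (j : WithTop J) := fun j => not_isMax_of_lt (WithTop.coe_lt_top j)
  have hVsucc : ∀ j : J, V (Order.succ (j : WithTop J)) = V j ⊔ A j := fun j => by
    refine le_antisymm (iSup_le fun i => ?_) (sup_le (hV (Order.le_succ _))
      (hAV (Order.lt_succ_of_not_isMax (hmax j))))
    obtain h | h := ((Order.lt_succ_iff_of_not_isMax (hmax j)).1 i.2).lt_or_eq
    · exact le_sup_of_le_left (hAV h)
    · rw [WithTop.coe_inj.1 h]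
      exact le_sup_right
  have e₀ : ((V ⊥ : Subobject X) : K) ≅ 0 :=
    (Subobject.underlying.mapIso (eqToIso hVbot)) ≪≫ Subobject.botCoeIsoZero
  have e₁ : ((V ⊤ : Subobject X) : K) ≅ X :=
    Subobject.underlying.mapIso (eqToIso hVtop) ≪≫ asIso (⊤ : Subobject X).arrow
  refine ⟨WithTop J, inferInstance, inferInstance, inferInstance, inferInstance,
    subobjectChain hV, _, colimitOfDiagramTerminal isTerminalTop _, e₀.symm, e₁,
    fun j hj => ?_, fun j hj => ?_, (isZero_zero K).eq_of_src _ _⟩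
  · induction j with
    | top => exact (hj isMax_top).elim
    | coe j =>
      obtain ⟨-, s, hs, e, he⟩ : QuotientRel S (V j) (V (Order.succ (j : WithTop J))) := by
        rw [hVsucc, hVcoe]
        exact hA j
      have hle := hV (Order.le_succ (j : WithTop J))
      have := isQuotientBy_cokernel_π (Subobject.ofLE _ _ hle)
        (V (Order.succ (j : WithTop J))).arrow
      simp only [Subobject.ofLE_arrow, Subobject.mk_arrow] at this
      exact ⟨inferInstanceAs (Mono (Subobject.ofLE _ _ hle)), s, hs, this.nonempty_iso he⟩
  · have : Nonempty {i // i < j} := ⟨⟨⊥, hj.bot_lt⟩⟩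
    refine nonempty_isColimit_coconeLT hV j (le_antisymm (iSup_le fun i => ?_)
      (iSup_le fun i => hV i.2.le))
    exact (hAV (Order.lt_succ_of_not_isMax (hmax i.1))).trans
      (le_iSup (fun i : {i // i < j} => V i) ⟨_, hj.succ_lt i.2⟩)

end Chains

section Generated

variable {K : Type u} [Category.{v} K] [Abelian K] [IsGrothendieckAbelian.{v} K] {G X : K}

lemma iSup_imageSubobject_of_isSeparator (hG : IsSeparator G) (B : K) :
    ⨆ g : G ⟶ B, imageSubobject g = ⊤ := by
  set z := ⨆ g : G ⟶ B, imageSubobject g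
  refine top_le_iff.1 (Subobject.le_of_factors ?_)
  have : cokernel.π z.arrow = 0 := (Preadditive.isSeparator_iff G).1 hG _ fun g => by
    rw [← factors_iff_comp_cokernel_π, ← imageSubobject_le_iff]
    exact le_iSup (fun g : G ⟶ B => imageSubobject g) g
  rw [factors_iff_comp_cokernel_π, this, comp_zero]

/-- The subobject `A` is a join of images of at most `κ` morphisms from `G`. -/
def IsGenerated (G : K) (κ : Type v) (A : Subobject X) : Prop :=
  ∃ (ι : Type v) (g : ι → (G ⟶ X)), Cardinal.mk ι ≤ Cardinal.mk κ ∧ ⨆ i, imageSubobject (g i) = A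

lemma IsGenerated.mono {κ κ' : Type v} (h : Cardinal.mk κ ≤ Cardinal.mk κ') {A : Subobject X}
    (hA : IsGenerated G κ A) : IsGenerated G κ' A := by
  obtain ⟨ι, g, hι, hg⟩ := hA
  exact ⟨ι, g, hι.trans h, hg⟩

lemma IsGenerated.iSup {κ : Type v} [Infinite κ] {ι : Type v}
    (hι : Cardinal.mk ι ≤ Cardinal.mk κ) {A : ι → Subobject X}
    (hA : ∀ i, IsGenerated G κ (A i)) : IsGenerated G κ (⨆ i, A i) := by
  choose J g hJ hg using hA
  refine ⟨Σ i, J i, fun p => g p.1 p.2, ?_, ?_⟩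
  · rw [Cardinal.mk_sigma]
    refine (Cardinal.sum_le_mk_mul_iSup _).trans ((mul_le_mul' hι (ciSup_le' hJ)).trans ?_)
    exact (Cardinal.mul_eq_self (Cardinal.aleph0_le_mk κ)).le
  · rw [iSup_sigma]
    simp only [hg]

lemma IsGenerated.exists_imageSubobject_eq {κ : Type v} {A : Subobject X}
    (hA : IsGenerated G κ A) : ∃ f : (∐ fun _ : κ => G) ⟶ X, imageSubobject f = A := by
  obtain ⟨ι, g, hι, rfl⟩ := hA
  obtain ⟨φ⟩ := hι
  refine ⟨Sigma.desc (Function.extend φ g 0), eq_of_forall_ge_iff fun z => ?_⟩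
  simp only [iSup_le_iff, imageSubobject_le_iff]
  constructor
  · intro h i
    have := Subobject.factors_of_factors_right (Sigma.ι (fun _ : κ => G) (φ i)) h
    simpa [φ.injective.extend_apply] using this
  · intro h
    refine factors_of_isColimit (coproductIsCoproduct fun _ : κ => G) _ fun ⟨k⟩ => ?_
    by_cases hk : ∃ i, φ i = k
    · obtain ⟨i, rfl⟩ := hk
      simpa [φ.injective.extend_apply] using h i
    · simpa [Function.extend_apply' _ _ _ hk] using Subobject.factors_zero

lemma exists_injective_Iic_imageSubobject {Z : K} (f : Z ⟶ X) :
    ∃ φ : Set.Iic (imageSubobject f) → Subobject Z, Function.Injective φ := by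
  refine ⟨fun w => (Subobject.pullback f).obj w, fun w w' h => Subtype.ext ?_⟩
  rw [← imageAlong_pullback (f := f) (w.2.trans imageAlong_top.ge),
    ← imageAlong_pullback (f := f) (w'.2.trans imageAlong_top.ge)]
  exact congrArg (imageAlong f) h

lemma IsQuotientBy.exists_isGenerated (hG : IsSeparator G) {κ : Type v} {a b : Subobject X}
    {s : K} {e : (b : K) ⟶ s} (h : IsQuotientBy a b.arrow e) (hab : a ≤ b)
    {φ : Subobject s → κ} (hφ : Function.Injective φ) :
    ∃ A, IsGenerated G κ A ∧ a ⊔ A = b := by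
  let ι := {k : κ // ∃ g : G ⟶ (b : K), φ (imageSubobject (g ≫ e)) = k}
  choose g hg using fun k : ι => k.2
  let W : Subobject (b : K) := (Subobject.pullback b.arrow).obj a ⊔ ⨆ k, imageSubobject (g k)
  have hb : imageAlong b.arrow ⊤ = b := imageAlong_top.trans (imageSubobject_subobject_arrow b)
  have hW : ⊤ ≤ W := by
    refine le_of_imageAlong_le (f := e) (fun T t ht => ?_) ?_
    · refine Subobject.factors_of_le t le_sup_left ?_
      rw [pullback_factors_iff]
      exact (h.2 T t).1 ht
    · rw [← iSup_imageSubobject_of_isSeparator hG, (gc_imageAlong (f := e)).l_iSup]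
      refine iSup_le fun g' => ?_
      have := hφ (hg ⟨_, g', rfl⟩)
      rw [imageAlong_imageSubobject, ← this, ← imageAlong_imageSubobject]
      exact gc_imageAlong.monotone_l
        (le_sup_of_le_right (le_iSup (fun k => imageSubobject (g k)) _))
  refine ⟨⨆ k, imageSubobject (g k ≫ b.arrow),
    ⟨ι, fun k => g k ≫ b.arrow, Cardinal.mk_subtype_le _, rfl⟩, ?_⟩
  calc _ = imageAlong b.arrow W := by
        simp only [W, (gc_imageAlong (f := b.arrow)).l_sup,
          (gc_imageAlong (f := b.arrow)).l_iSup, imageAlong_imageSubobject]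
        rw [imageAlong_pullback (hab.trans hb.ge)]
    _ = b := by rw [top_le_iff.1 hW, hb]

/-- The steps of a filtration can be chosen to be generated by few morphisms. -/
lemma FilteredBetween.exists_isGenerated (hG : IsSeparator G) {κ : Type v} {S : Set K}
    (hS : ∀ s ∈ S, ∃ φ : Subobject s → κ, Function.Injective φ)
    (h : FilteredBetween.{v} (QuotientRel S) (⊥ : Subobject X) ⊤) :
    ∃ (J : Type v) (_ : LinearOrder J) (_ : WellFoundedLT J) (A : J → Subobject X),
      ⨆ j, A j = ⊤ ∧ (∀ j, IsGenerated G κ (A j)) ∧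
        ∀ j, QuotientRel S (stage ⊥ A j) (stage ⊥ A j ⊔ A j) := by
  obtain ⟨J, _, _, A, hA, hR⟩ := h.exists_strict
  have : ∀ j, ∃ B, IsGenerated G κ B ∧ stage ⊥ A j ⊔ B = stage ⊥ A j ⊔ A j := fun j => by
    obtain ⟨hle, s, hs, e, he⟩ := hR j
    obtain ⟨φ, hφ⟩ := hS s hs
    exact he.exists_isGenerated hG hle hφ
  choose B hB hAB using this
  have hst : ∀ j, stage ⊥ B j = stage ⊥ A j := fun j => by
    induction j using WellFoundedLT.induction with
    | _ j ih =>
      refine le_antisymm (stage_le bot_le fun i hi => ?_) (stage_le bot_le fun i hi => ?_)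
      · exact (le_sup_right.trans (hAB i).le).trans
          (sup_le (stage_mono hi.le) (apply_le_stage hi))
      · refine (le_sup_right.trans (hAB i).ge).trans (sup_le ?_ (apply_le_stage hi))
        rw [← ih i hi]
        exact stage_mono hi.le
  refine ⟨J, inferInstance, inferInstance, B, ?_, hB, fun j => ?_⟩
  · rw [bot_sup_eq] at hA
    refine top_le_iff.1 (hA.ge.trans (iSup_le fun j => ?_))
    refine (le_sup_right.trans (hAB j).ge).trans (sup_le ?_ (le_iSup B j))
    rw [← hst]
    exact stage_le bot_le fun i _ => le_iSup B i
  · rw [hst, hAB]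
    exact hR j

end Generated

section Closure

lemma mk_setOf_reflTransGen_le {I κ : Type v} [Infinite κ] {r : I → I → Prop}
    (hr : ∀ i, Cardinal.mk {j | r i j} ≤ Cardinal.mk κ) (i : I) :
    Cardinal.mk {j | Relation.ReflTransGen r i j} ≤ Cardinal.mk κ := by
  have hκ := Cardinal.aleph0_le_mk κ
  let F : Set I → Set I := fun T => ⋃ j ∈ T, {k | r j k}
  have hF : ∀ T : Set I, Cardinal.mk T ≤ Cardinal.mk κ → Cardinal.mk (F T) ≤ Cardinal.mk κ :=
    fun T hT => (Cardinal.mk_biUnion_le _ _).trans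
      ((mul_le_mul' hT (ciSup_le' fun _ => hr _)).trans (Cardinal.mul_eq_self hκ).le)
  have hT : ∀ n, Cardinal.mk (F^[n] {i}) ≤ Cardinal.mk κ := fun n => by
    induction n with
    | zero => exact (Cardinal.mk_singleton i).le.trans (Cardinal.one_le_aleph0.trans hκ)
    | succ n ih =>
      rw [Function.iterate_succ_apply']
      exact hF _ ih
  have hle : {j | Relation.ReflTransGen r i j} ⊆ ⋃ n : ULift.{v} ℕ, F^[n.down] {i} := by
    intro j hj
    induction hj with
    | refl => exact Set.mem_iUnion.2 ⟨⟨0⟩, rfl⟩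
    | tail _ h ih =>
      obtain ⟨⟨n⟩, hn⟩ := Set.mem_iUnion.1 ih
      refine Set.mem_iUnion.2 ⟨⟨n + 1⟩, ?_⟩
      rw [Function.iterate_succ_apply']
      exact Set.mem_biUnion hn h
  refine (Cardinal.mk_le_mk_of_subset hle).trans ((Cardinal.mk_iUnion_le _).trans ?_)
  have hN : Cardinal.mk (ULift.{v} ℕ) ≤ Cardinal.mk κ := Cardinal.mk_le_aleph0.trans hκ
  exact Cardinal.mul_le_of_le hκ hN (ciSup_le' fun n => hT n.down)

end Closure

section Complexes

variable {K : Type u} [Category.{v} K] [Abelian K] {c : ComplexShape w}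
  {X : HomologicalComplex K c}

/-- The component of a subcomplex in degree `n`. -/
noncomputable def subobjectX (n : w) (z : Subobject X) : Subobject (X.X n) :=
  Subobject.mk (z.arrow.f n)

lemma subobjectX_mk (n : w) {Y : HomologicalComplex K c} (f : Y ⟶ X) [Mono f] :
    subobjectX n (Subobject.mk f) = Subobject.mk (f.f n) := by
  refine Subobject.mk_eq_mk_of_comm _ _
    ((HomologicalComplex.eval K c n).mapIso (Subobject.underlyingIso f)) ?_
  rw [← Subobject.underlyingIso_hom_comp_eq_mk]
  rfl

lemma subobjectX_le_iff {z z' : Subobject X} :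
    (∀ n, subobjectX n z ≤ subobjectX n z') ↔ z ≤ z' := by
  constructor
  · intro h
    have h' : ∀ n, ∃ l : (z : HomologicalComplex K c).X n ⟶ (z' : HomologicalComplex K c).X n,
        l ≫ z'.arrow.f n = z.arrow.f n := fun n =>
      (Subobject.mk_factors_iff _ _).1
        (Subobject.factors_of_le _ (h n) (Subobject.mk_factors_self _))
    choose l hl using h'
    refine Subobject.le_of_comm ⟨l, fun i j _ => ?_⟩ ?_
    · rw [← cancel_mono (z'.arrow.f j), assoc, assoc, hl, ← z'.arrow.comm, ← assoc, hl,
        z.arrow.comm]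
    · ext n
      exact hl n
  · intro h n
    refine Subobject.mk_le_mk_of_comm ((Subobject.ofLE z z' h).f n) ?_
    rw [← HomologicalComplex.comp_f, Subobject.ofLE_arrow]

section OfDegreewise

variable (V : ∀ n, Subobject (X.X n)) (hV : ∀ n m, imageAlong (X.d n m) (V n) ≤ V m)

lemma factors_of_imageAlong_le {A B : K} {f : A ⟶ B} {x : Subobject A} {y : Subobject B}
    (h : imageAlong f x ≤ y) : y.Factors (x.arrow ≫ f) :=
  Subobject.factors_of_le _ h (imageAlong_factors (Subobject.factors_self x))

/-- The complex with given components stable under the differentials. -/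
noncomputable def complexOfDegreewise : HomologicalComplex K c where
  X n := (V n : K)
  d n m := (V m).factorThru ((V n).arrow ≫ X.d n m) (factors_of_imageAlong_le (hV n m))
  shape n m h := by
    rw [← cancel_mono (V m).arrow, Subobject.factorThru_arrow, X.shape n m h, comp_zero,
      zero_comp]
  d_comp_d' n m k _ _ := by rw [← cancel_mono (V k).arrow]; simp

/-- The inclusion of the complex with given components. -/
noncomputable def complexOfDegreewiseι : complexOfDegreewise V hV ⟶ X where
  f n := (V n).arrow
  comm' n m _ := by simp [complexOfDegreewise]

instance : Mono (complexOfDegreewiseι V hV) :=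
  HomologicalComplex.mono_of_mono_f _ fun n => inferInstanceAs (Mono (V n).arrow)

/-- The subcomplex with given components stable under the differentials. -/
noncomputable def subobjectOfDegreewise : Subobject X :=
  Subobject.mk (complexOfDegreewiseι V hV)

lemma subobjectX_subobjectOfDegreewise (n : w) :
    subobjectX n (subobjectOfDegreewise V hV) = V n :=
  (subobjectX_mk n _).trans (Subobject.mk_arrow (V n))

end OfDegreewise

lemma isQuotientBy_cokernel_f {a b : Subobject X} (h : a ≤ b) (n : w) :
    IsQuotientBy (subobjectX n a) (b.arrow.f n) ((cokernel.π (Subobject.ofLE a b h)).f n) := by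
  let Φ := HomologicalComplex.eval K c n
  have key := (isQuotientBy_cokernel_π (Φ.map (Subobject.ofLE a b h)) (Φ.map b.arrow)).comp_iso
    (PreservesCokernel.iso Φ (Subobject.ofLE a b h)).symm
  rw [Iso.symm_hom, PreservesCokernel.iso_inv, π_comp_cokernelComparison] at key
  have ha : Subobject.mk (Φ.map (Subobject.ofLE a b h) ≫ Φ.map b.arrow) = subobjectX n a := by
    simp only [← Φ.map_comp, Subobject.ofLE_arrow]
    rfl
  rwa [ha] at key

lemma isQuotientBy_cokernel_ofLE {L : Type u} [Category.{v} L] [Abelian L] {X : L}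
    {a b : Subobject X} (h : a ≤ b) :
    IsQuotientBy a b.arrow (cokernel.π (Subobject.ofLE a b h)) := by
  have key := isQuotientBy_cokernel_π (Subobject.ofLE a b h) b.arrow
  have ha : Subobject.mk (Subobject.ofLE a b h ≫ b.arrow) = a := by
    simp only [Subobject.ofLE_arrow, Subobject.mk_arrow]
  rwa [ha] at key

end Complexes

section FilteredComplexes

variable {K : Type u} [Category.{v} K] [Abelian K]

lemma IsQuotientBy.exists_of_imageSubobject_eq {X B Q : K} {a b : Subobject X} {m : B ⟶ X}
    {e : B ⟶ Q} (h : IsQuotientBy a m e) (hb : imageSubobject m = b) :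
    ∃ e' : (b : K) ⟶ Q, IsQuotientBy a b.arrow e' := by
  subst hb
  obtain ⟨Q', e', h'⟩ := exists_isQuotientBy a (imageSubobject m).arrow
  have h₁ := h'.epi_comp (factorThruImageSubobject m)
  rw [imageSubobject_arrow_comp] at h₁
  obtain ⟨i⟩ := h₁.nonempty_iso h
  exact ⟨_, h'.comp_iso i⟩

lemma IsQuotientBy.exists_epi {X B Q Z : K} {x y : Subobject X} {m : B ⟶ X} {e : B ⟶ Q}
    (h : IsQuotientBy y m e) (hm : imageSubobject m = x ⊔ y) {g : Z ⟶ X}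
    (hg : imageSubobject g = x) : ∃ f : Z ⟶ Q, Epi f := by
  subst hg
  obtain ⟨e', h'⟩ := h.exists_of_imageSubobject_eq hm
  have := h'.ofLE_sup.1
  exact ⟨factorThruImageSubobject g ≫ Subobject.ofLE _ _ le_sup_left ≫ e',
    CategoryTheory.epi_comp _ _⟩

variable {c : ComplexShape ℤ} {X : HomologicalComplex K c} [IsGrothendieckAbelian.{v} K]
  {J : ℤ → Type v} (A : ∀ n, J n → Subobject (X.X n))

/-- The join of the members of degree `n` with index in `T` of a family of subobjects of the
components of a complex. -/
noncomputable def joinAt (T : Set (Σ n, J n)) (n : ℤ) : Subobject (X.X n) :=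
  joinOver (A n) (Sigma.mk n ⁻¹' T)

lemma joinAt_mono {T T' : Set (Σ n, J n)} (h : T ⊆ T') (n : ℤ) : joinAt A T n ≤ joinAt A T' n :=
  joinOver_mono _ (Set.preimage_mono h)

lemma joinAt_iUnion_le {α : Type*} {T : α → Set (Σ n, J n)} {n : ℤ} {z : Subobject (X.X n)}
    (h : ∀ i, joinAt A (T i) n ≤ z) : joinAt A (⋃ i, T i) n ≤ z :=
  joinOver_le fun j hj => by
    obtain ⟨i, hi⟩ := Set.mem_iUnion.1 hj
    exact (le_joinOver (S := Sigma.mk n ⁻¹' T i) hi).trans (h i)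

lemma joinAt_union (T T' : Set (Σ n, J n)) (n : ℤ) :
    joinAt A (T ∪ T') n = joinAt A T n ⊔ joinAt A T' n :=
  joinOver_union _ _ _

variable [∀ n, LinearOrder (J n)]

/-- An index set giving rise to a subcomplex whose components are filtered. -/
structure IsStable (T : Set (Σ n, J n)) : Prop where
  isHillClosed (n : ℤ) : IsHillClosed (A n) (Sigma.mk n ⁻¹' T)
  imageAlong_le (n m : ℤ) : imageAlong (X.d n m) (joinAt A T n) ≤ joinAt A T m

variable {A}

lemma IsStable.iUnion {α : Type*} {T : α → Set (Σ n, J n)} (hT : ∀ i, IsStable A (T i)) :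
    IsStable A (⋃ i, T i) where
  isHillClosed n j hj := by
    obtain ⟨i, hi⟩ := Set.mem_iUnion.1 hj
    exact ((hT i).isHillClosed n j hi).trans
      (joinOver_mono _ (Set.inter_subset_inter_left _ (Set.preimage_mono (Set.subset_iUnion T i))))
  imageAlong_le n m := imageAlong_le_iff.2 (joinAt_iUnion_le A fun i => imageAlong_le_iff.1
    (((hT i).imageAlong_le n m).trans (joinAt_mono A (Set.subset_iUnion T i) m)))

lemma IsStable.union {T T' : Set (Σ n, J n)} (hT : IsStable A T) (hT' : IsStable A T') :
    IsStable A (T ∪ T') := by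
  rw [Set.union_eq_iUnion]
  exact IsStable.iUnion fun b => by cases b <;> assumption

/-- The subcomplex given by a stable index set. -/
noncomputable def IsStable.subcomplex {T : Set (Σ n, J n)} (hT : IsStable A T) : Subobject X :=
  subobjectOfDegreewise (joinAt A T) hT.imageAlong_le

lemma IsStable.subobjectX_subcomplex {T : Set (Σ n, J n)} (hT : IsStable A T) (n : ℤ) :
    subobjectX n hT.subcomplex = joinAt A T n :=
  subobjectX_subobjectOfDegreewise _ _ n

lemma IsStable.subcomplex_le_iff {T : Set (Σ n, J n)} (hT : IsStable A T) {z : Subobject X} :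
    hT.subcomplex ≤ z ↔ ∀ n, joinAt A T n ≤ subobjectX n z := by
  simp only [← subobjectX_le_iff, hT.subobjectX_subcomplex]

lemma IsStable.subcomplex_mono {T T' : Set (Σ n, J n)} (hT : IsStable A T) (hT' : IsStable A T')
    (h : T ⊆ T') : hT.subcomplex ≤ hT'.subcomplex := by
  rw [hT.subcomplex_le_iff]
  intro n
  rw [hT'.subobjectX_subcomplex]
  exact joinAt_mono A h n

lemma IsStable.subcomplex_iUnion_le {α : Type*} {T : α → Set (Σ n, J n)}
    (hT : ∀ i, IsStable A (T i)) {z : Subobject X} (h : ∀ i, (hT i).subcomplex ≤ z) :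
    (IsStable.iUnion hT).subcomplex ≤ z := by
  rw [IsStable.subcomplex_le_iff]
  exact fun n => joinAt_iUnion_le A fun i => (hT i).subcomplex_le_iff.1 (h i) n

lemma IsStable.subcomplex_union_le {T T' : Set (Σ n, J n)} (hT : IsStable A T)
    (hT' : IsStable A T') : (hT.union hT').subcomplex ≤ hT.subcomplex ⊔ hT'.subcomplex := by
  rw [IsStable.subcomplex_le_iff]
  intro n
  rw [joinAt_union]
  exact sup_le (hT.subcomplex_le_iff.1 le_sup_left n) (hT'.subcomplex_le_iff.1 le_sup_right n)

variable {G : K}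

lemma IsGenerated.imageAlong {B Y : K} {μ : Type v} {z : Subobject B} (hz : IsGenerated G μ z)
    (f : B ⟶ Y) : IsGenerated G μ (imageAlong f z) := by
  obtain ⟨ι, g, hι, rfl⟩ := hz
  refine ⟨ι, fun i => g i ≫ f, hι, ?_⟩
  simp only [(gc_imageAlong (f := f)).l_iSup, imageAlong_imageSubobject]

lemma IsGenerated.exists_injective_Iic {B : K} {μ κ : Type v} {y z : Subobject B}
    (hz : IsGenerated G μ z) (hy : y ≤ z) {φ : Subobject (∐ fun _ : μ => G) → κ}
    (hφ : Function.Injective φ) : ∃ f : Set.Iic y → κ, Function.Injective f := by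
  obtain ⟨f, rfl⟩ := hz.exists_imageSubobject_eq
  obtain ⟨ψ, hψ⟩ := exists_injective_Iic_imageSubobject f
  exact ⟨fun w => φ (ψ ⟨w, w.2.trans hy⟩), fun w w' h =>
    Subtype.ext (Subtype.mk.inj (hψ (hφ h)))⟩

lemma exists_small_isStable {μ κ : Type v} [Infinite κ]
    {φ : Subobject (∐ fun _ : μ => G) → κ} (hφ : Function.Injective φ)
    (htop : ∀ n, ⨆ j, A n j = ⊤) (hA : ∀ n j, IsGenerated G μ (A n j)) (i : Σ n, J n) :
    ∃ T : Set (Σ n, J n), i ∈ T ∧ Cardinal.mk ↥T ≤ Cardinal.mk κ ∧ IsStable A T := by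
  have hκ := Cardinal.aleph0_le_mk κ
  have hH : ∀ i : Σ n, J n, ∃ H ⊆ Set.Iio i.2, Cardinal.mk H ≤ Cardinal.mk κ ∧
      A i.1 i.2 ⊓ stage ⊥ (A i.1) i.2 ≤ joinOver (A i.1) H := fun i =>
    exists_small_joinOver_le (isUpperContinuous_subobject _) _
      ((hA i.1 i.2).exists_injective_Iic inf_le_left hφ)
      (inf_le_right.trans (stage_le bot_le fun j hj => le_joinOver hj))
  have hD : ∀ (i : Σ n, J n) (m : ℤ), ∃ D : Set (J m), D ⊆ Set.univ ∧
      Cardinal.mk D ≤ Cardinal.mk κ ∧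
      imageAlong (X.d i.1 m) (A i.1 i.2) ≤ joinOver (A m) D := fun i m =>
    exists_small_joinOver_le (isUpperContinuous_subobject _) _
      (((hA i.1 i.2).imageAlong _).exists_injective_Iic le_rfl hφ)
      (by simp [joinOver, htop])
  choose H hHlt hHκ hHle using hH
  choose D _ hDκ hDle using hD
  let r : (Σ n, J n) → (Σ n, J n) → Prop := fun i j =>
    j ∈ Sigma.mk i.1 '' H i ∪ ⋃ m : ULift.{v} ℤ, Sigma.mk m.down '' D i m.down
  have hr : ∀ i, Cardinal.mk {j | r i j} ≤ Cardinal.mk κ := fun i => by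
    refine (Cardinal.mk_union_le _ _).trans (Cardinal.add_le_of_le hκ
      (Cardinal.mk_image_le.trans (hHκ i)) ((Cardinal.mk_iUnion_le _).trans ?_))
    have hZ : Cardinal.mk (ULift.{v} ℤ) ≤ Cardinal.mk κ := Cardinal.mk_le_aleph0.trans hκ
    exact Cardinal.mul_le_of_le hκ hZ
      (ciSup_le' fun m => Cardinal.mk_image_le.trans (hDκ i m.down))
  refine ⟨{j | Relation.ReflTransGen r i j}, Relation.ReflTransGen.refl,
    mk_setOf_reflTransGen_le hr i, ⟨fun n j hj => ?_, fun n m => ?_⟩⟩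
  · exact (hHle ⟨n, j⟩).trans (joinOver_mono _ fun k hk =>
      ⟨hj.tail (Or.inl ⟨k, hk, rfl⟩), hHlt _ hk⟩)
  · refine imageAlong_le_iff.2 (joinOver_le fun j hj => imageAlong_le_iff.1 ?_)
    exact (hDle ⟨n, j⟩ m).trans (joinOver_mono _ fun k hk =>
      hj.tail (Or.inr (Set.mem_iUnion.2 ⟨⟨m⟩, k, hk, rfl⟩)))

end FilteredComplexes

section Deconstructibility

variable {K : Type u} [Category.{v} K] [Abelian K] {c : ComplexShape ℤ}

lemma QuotientRel.of_iso {X : K} {S S' : Set K} (hS : ∀ s ∈ S, ∃ s' ∈ S', Nonempty (s ≅ s'))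
    {a b : Subobject X} (h : QuotientRel S a b) : QuotientRel S' a b := by
  obtain ⟨hab, s, hs, e, he⟩ := h
  obtain ⟨s', hs', ⟨i⟩⟩ := hS s hs
  exact ⟨hab, s', hs', _, he.comp_iso i⟩

lemma exists_iso_cokernel_subobject_arrow {Z Y : K} (f : Z ⟶ Y) [Epi f] :
    ∃ z : Subobject Z, Nonempty (Y ≅ cokernel z.arrow) := by
  have h : IsQuotientBy (kernelSubobject f) (𝟙 Z) f :=
    ⟨inferInstance, fun T t => by rw [kernelSubobject_factors_iff, comp_id]⟩
  have h' : IsQuotientBy (kernelSubobject f) (𝟙 Z) (cokernel.π (kernelSubobject f).arrow) :=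
    ⟨inferInstance, fun T t => by rw [factors_iff_comp_cokernel_π, comp_id]⟩
  exact ⟨_, h.nonempty_iso h'⟩

/-- The data of a complex with components in a family of objects. -/
structure ComplexData {D : Type v} (q : D → K) (c : ComplexShape ℤ) : Type v where
  index : ℤ → D
  d : ∀ i j, q (index i) ⟶ q (index j)
  shape : ∀ i j, ¬ c.Rel i j → d i j = 0
  d_comp_d' : ∀ i j k, c.Rel i j → c.Rel j k → d i j ≫ d j k = 0

/-- The complex with given data. -/
def ComplexData.complex {D : Type v} {q : D → K} (x : ComplexData q c) :
    HomologicalComplex K c where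
  X n := q (x.index n)
  d := x.d
  shape := x.shape
  d_comp_d' := x.d_comp_d'

lemma ComplexData.exists_iso {D : Type v} (q : D → K) {Y : HomologicalComplex K c}
    (hY : ∀ n, ∃ p, Nonempty (Y.X n ≅ q p)) :
    ∃ x : ComplexData q c, Nonempty (Y ≅ x.complex) := by
  choose p hp using hY
  let e := fun n => (hp n).some
  exact ⟨⟨p, fun i j => (e i).inv ≫ Y.d i j ≫ (e j).hom, fun i j h => by simp [Y.shape i j h],
    fun i j k _ _ => by simp⟩,
    ⟨HomologicalComplex.Hom.isoOfComponents e fun i j _ => by simp [ComplexData.complex]⟩⟩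

lemma exists_family_complexData {D : Type v} (q : D → K) (P : Set (HomologicalComplex K c))
    (hP : ∀ Y ∈ P, ∀ n, ∃ p, Nonempty (Y.X n ≅ q p)) :
    ∃ (ι : Type v) (s : ι → HomologicalComplex K c), (∀ i, s i ∈ P) ∧
      ∀ Y ∈ P, ∃ s' ∈ Set.range s, Nonempty (Y ≅ s') := by
  let ι := {x : ComplexData q c // ∃ Y ∈ P, Nonempty (Y ≅ x.complex)}
  choose t ht hts using fun x : ι => x.2
  refine ⟨ι, t, ht, fun Y hY => ?_⟩
  obtain ⟨x, ⟨i⟩⟩ := ComplexData.exists_iso q (hP Y hY)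
  let x' : ι := ⟨x, Y, hY, ⟨i⟩⟩
  exact ⟨t x', ⟨x', rfl⟩, ⟨i ≪≫ (hts x').some.symm⟩⟩

variable [IsGrothendieckAbelian.{v} K]

lemma filteredBy_subset {S S' : Set K} (hS : S ⊆ filteredBy S') :
    filteredBy S ⊆ filteredBy S' := fun X hX => by
  refine mem_filteredBy_of_filteredBetween
    ((filteredBetween_of_mem_filteredBy hX).mono fun a b => ?_).refine
  rintro ⟨hab, s, hs, e, he⟩
  exact (he.filteredBetween_iff S' (imageSubobject_subobject_arrow b) hab).2
    (filteredBetween_of_mem_filteredBy (hS hs))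

/-- Complexes whose components are quotients of a fixed object form an essentially small
class. -/
lemma exists_family_of_epi (Z : K) (P : Set (HomologicalComplex K c))
    (hP : ∀ Y ∈ P, ∀ n, ∃ f : Z ⟶ Y.X n, Epi f) :
    ∃ (ι : Type v) (s : ι → HomologicalComplex K c), (∀ i, s i ∈ P) ∧
      ∀ Y ∈ P, ∃ s' ∈ Set.range s, Nonempty (Y ≅ s') := by
  refine exists_family_complexData
    (fun p : Shrink.{v} (Subobject Z) => cokernel ((equivShrink (Subobject Z)).symm p).arrow) P
    fun Y hY n => ?_
  obtain ⟨f, _⟩ := hP Y hY n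
  obtain ⟨z, hz⟩ := exists_iso_cokernel_subobject_arrow f
  obtain ⟨p, rfl⟩ := (equivShrink (Subobject Z)).symm.surjective z
  exact ⟨p, hz⟩

variable {X : HomologicalComplex K c} {J : ℤ → Type v} {A : ∀ n, J n → Subobject (X.X n)} {G : K}

lemma isGenerated_joinAt {κ : Type v} [Infinite κ] (hA : ∀ n j, IsGenerated G κ (A n j))
    {T : Set (Σ n, J n)} (hT : Cardinal.mk T ≤ Cardinal.mk κ) (n : ℤ) :
    IsGenerated G κ (joinAt A T n) := by
  rw [joinAt, joinOver, iSup_subtype']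
  exact IsGenerated.iSup
    ((Cardinal.mk_preimage_of_injective _ _ sigma_mk_injective).trans hT) fun j => hA n j

variable [∀ n, LinearOrder (J n)]

lemma IsStable.imageSubobject_arrow_f {T : Set (Σ n, J n)} (hT : IsStable A T) (n : ℤ) :
    imageSubobject (hT.subcomplex.arrow.f n) = joinAt A T n := by
  rw [imageSubobject_mono]
  exact hT.subobjectX_subcomplex n

variable [∀ n, WellFoundedLT (J n)]

lemma IsStable.quotientRel_union {κ : Type v} [Infinite κ] {S : Set K}
    (hA : ∀ n j, IsGenerated G κ (A n j))
    (hR : ∀ n j, QuotientRel S (stage ⊥ (A n) j) (stage ⊥ (A n) j ⊔ A n j))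
    {T T' : Set (Σ n, J n)} (hT : IsStable A T) (hT' : IsStable A T')
    (hκ : Cardinal.mk T' ≤ Cardinal.mk κ) :
    QuotientRel {Y : HomologicalComplex K c | (∀ n, Y.X n ∈ filteredBy S) ∧
      ∀ n, ∃ f : (∐ fun _ : κ => G) ⟶ Y.X n, Epi f}
      hT.subcomplex (hT.union hT').subcomplex := by
  have hle := hT.subcomplex_mono (hT.union hT') Set.subset_union_left
  refine ⟨hle, _, ⟨fun n => ?_, fun n => ?_⟩, _, isQuotientBy_cokernel_ofLE hle⟩
  all_goals
    have h := isQuotientBy_cokernel_f hle n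
    have him := (hT.union hT').imageSubobject_arrow_f n
    rw [hT.subobjectX_subcomplex] at h
  · exact mem_filteredBy_of_filteredBetween
      ((h.filteredBetween_iff S him (joinAt_mono A Set.subset_union_left n)).1
        (IsHillClosed.filteredBetween (isUpperContinuous_subobject _) (quotientRel_sup_iff S)
          (fun j => Or.inr (hR n j)) (Set.preimage_mono Set.subset_union_left)
          (hT.isHillClosed n) ((hT.union hT').isHillClosed n)))
  · obtain ⟨g, hg⟩ := (isGenerated_joinAt hA hκ n).exists_imageSubobject_eq
    rw [joinAt_union, sup_comm] at him
    exact h.exists_epi him hg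

/-- A complex is filtered by the stable subcomplexes of any covering family. -/
lemma filteredBetween_of_isStable [c.HasNoLoop] {κ : Type v} [Infinite κ] {S : Set K}
    (htop : ∀ n, ⨆ j, A n j = ⊤) (hA : ∀ n j, IsGenerated G κ (A n j))
    (hR : ∀ n j, QuotientRel S (stage ⊥ (A n) j) (stage ⊥ (A n) j ⊔ A n j))
    {I : Type v} {T : I → Set (Σ n, J n)} (hmem : ∀ p, ∃ i, p ∈ T i)
    (hTκ : ∀ i, Cardinal.mk (T i) ≤ Cardinal.mk κ) (hT : ∀ i, IsStable A (T i)) :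
    FilteredBetween.{v} (QuotientRel {Y : HomologicalComplex K c | (∀ n, Y.X n ∈ filteredBy S) ∧
      ∀ n, ∃ f : (∐ fun _ : κ => G) ⟶ Y.X n, Epi f}) (⊥ : Subobject X) ⊤ := by
  obtain ⟨_, _⟩ := exists_wellFoundedLT I
  have hU : ∀ i, IsStable A (⋃ j : Set.Iio i, T j) := fun i => IsStable.iUnion fun j => hT j.1
  have hst : ∀ i, stage ⊥ (fun i => (hT i).subcomplex) i = (hU i).subcomplex := fun i =>
    le_antisymm
      (stage_le bot_le fun j hj => (hT j).subcomplex_mono (hU i)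
        (Set.subset_iUnion (fun j : Set.Iio i => T j) ⟨j, hj⟩))
      (IsStable.subcomplex_iUnion_le _ fun j =>
        apply_le_stage (A := fun i => (hT i).subcomplex) j.2)
  have hcov : ⊤ ≤ ⊥ ⊔ ⨆ i, (hT i).subcomplex := subobjectX_le_iff.1 fun n => by
    refine le_top.trans ((htop n).ge.trans (iSup_le fun j => ?_))
    obtain ⟨i, hi⟩ := hmem ⟨n, j⟩
    exact (le_joinOver (S := Sigma.mk n ⁻¹' T i) hi).trans
      ((hT i).subcomplex_le_iff.1
        (le_sup_of_le_right (le_iSup (fun i => (hT i).subcomplex) i)) n)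
  refine ⟨I, inferInstance, inferInstance, fun i => (hT i).subcomplex, top_le_iff.1 hcov,
    fun i => Or.inr ?_⟩
  have hsup : (hU i).subcomplex ⊔ (hT i).subcomplex = ((hU i).union (hT i)).subcomplex :=
    le_antisymm (sup_le ((hU i).subcomplex_mono _ Set.subset_union_left)
      ((hT i).subcomplex_mono _ Set.subset_union_right)) ((hU i).subcomplex_union_le (hT i))
  rw [hst, hsup]
  exact (hU i).quotientRel_union hA hR (hT i) (hTκ i)

/-- The generalized Hill lemma for complexes: a complex with filtered components is filtered by
small complexes with filtered components. -/
lemma filteredBetween_complex [c.HasNoLoop] (hG : IsSeparator G) {μ κ : Type v} [Infinite κ]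
    {S : Set K} (hμκ : Cardinal.mk μ ≤ Cardinal.mk κ)
    (hS : ∀ s ∈ S, ∃ φ : Subobject s → μ, Function.Injective φ)
    {φ : Subobject (∐ fun _ : μ => G) → κ} (hφ : Function.Injective φ)
    {X : HomologicalComplex K c} (hX : ∀ n, X.X n ∈ filteredBy S) :
    FilteredBetween.{v} (QuotientRel {Y : HomologicalComplex K c | (∀ n, Y.X n ∈ filteredBy S) ∧
      ∀ n, ∃ f : (∐ fun _ : κ => G) ⟶ Y.X n, Epi f}) (⊥ : Subobject X) ⊤ := by
  choose J _ _ A htop hA hR using fun n =>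
    (filteredBetween_of_mem_filteredBy (hX n)).exists_isGenerated hG hS
  choose T hmem hTκ hT using exists_small_isStable hφ htop hA
  exact filteredBetween_of_isStable htop (fun n j => (hA n j).mono hμκ) hR
    (fun p => ⟨p, hmem p⟩) hTκ hT

end Deconstructibility

/-- if `C` is a deconstructible class of objects of a Grothendieck abelian
category `K`, then the class of complexes over `K` all of whose components lie in `C`
is deconstructible in the category of complexes. -/
theorem complexes_deconstructible {K : Type u} [Category.{v} K] [Abelian K]
    [HasColimits K] [HasFilteredColimits K] [AB5 K]
    (hgen : ∃ G : K, IsSeparator G)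
    (C : Set K) (hC : Deconstructible C) :
    Deconstructible
      {X : HomologicalComplex K (ComplexShape.up ℤ) | ∀ n : ℤ, X.X n ∈ C} := by
  obtain ⟨G, hG⟩ := hgen
  have : HasSeparator K := ⟨G, hG⟩
  have : AB5OfSize.{v, v} K := inferInstance
  have : IsGrothendieckAbelian.{v} K := { }
  obtain ⟨ι, s, rfl⟩ := hC
  let μ := Σ i, Shrink.{v} (Subobject (s i))
  let κ := ℕ ⊕ μ ⊕ Shrink.{v} (Subobject (∐ fun _ : μ => G))
  have hμκ : Cardinal.mk μ ≤ Cardinal.mk κ :=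
    Cardinal.mk_le_of_injective (Sum.inr_injective.comp Sum.inl_injective)
  have hS : ∀ t ∈ Set.range s, ∃ φ : Subobject t → μ, Function.Injective φ := by
    rintro _ ⟨i, rfl⟩
    exact ⟨fun z => ⟨i, equivShrink _ z⟩, sigma_mk_injective.comp (equivShrink _).injective⟩
  have hφ : Function.Injective fun z => (Sum.inr (Sum.inr (equivShrink _ z)) : κ) :=
    Sum.inr_injective.comp (Sum.inr_injective.comp (equivShrink _).injective)
  obtain ⟨ι', s', hs', hP⟩ := exists_family_of_epi (c := ComplexShape.up ℤ)
    (∐ fun _ : κ => G) {Y | (∀ n, Y.X n ∈ filteredBy (Set.range s)) ∧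
      ∀ n, ∃ f : (∐ fun _ : κ => G) ⟶ Y.X n, Epi f} fun Y hY => hY.2
  refine ⟨ι', s', Set.Subset.antisymm (fun X hX => ?_) fun X hX n => ?_⟩
  · exact mem_filteredBy_of_filteredBetween
      ((filteredBetween_complex hG hμκ hS hφ hX).mono fun _ _ => QuotientRel.of_iso hP)
  · have : PreservesColimitsOfSize.{v, v} (HomologicalComplex.eval K (ComplexShape.up ℤ) n) := { }
    refine filteredBy_subset Set.Subset.rfl (map_mem_filteredBy
      (HomologicalComplex.eval K (ComplexShape.up ℤ) n) ?_ hX)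
    rintro _ ⟨i, rfl⟩
    exact (hs' i).1 n

end CellularPaper
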